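/- For all integers k ≥ 1 and ℓ ≥ 3 there exists a k-apex simple graph G with exactly n = 11ℓk − 5k + 1 vertices such that cr_{k-apex}(G) ≥ ℓk and cr(G) ≤ 3k (hence the k-apex crossing ratio is Ω(n/k)). -/

import Mathlib

open Set

noncomputable section

/-- A drawing of a simple graph in the plane: vertices are mapped to distinct
points, each edge `uv` is drawn as a simple arc joining the images of `u` and
`v` and avoiding the images of the other vertices, any two arcs meet in
finitely many points, and no three arcs pass through a common non-vertex
point. -/
structure Drawing {V : Type} (G : SimpleGraph V) where
  vpos : V → ℝ × ℝ
  vpos_inj : Function.Injective vpos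
  arc : V → V → ℝ → ℝ × ℝ
  arc_symm : ∀ u v t, arc u v t = arc v u (1 - t)
  arc_cont : ∀ u v, G.Adj u v → ContinuousOn (arc u v) (Set.Icc 0 1)
  arc_injOn : ∀ u v, G.Adj u v → Set.InjOn (arc u v) (Set.Icc 0 1)
  arc_start : ∀ u v, G.Adj u v → arc u v 0 = vpos u
  arc_end : ∀ u v, G.Adj u v → arc u v 1 = vpos v
  arc_avoids : ∀ u v, G.Adj u v → ∀ t ∈ Set.Ioo (0:ℝ) 1, arc u v t ∉ Set.range vpos
  inter_finite : ∀ u v w z, G.Adj u v → G.Adj w z → s(u, v) ≠ s(w, z) →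
    ((arc u v '' Set.Icc 0 1) ∩ (arc w z '' Set.Icc 0 1)).Finite
  no_triple_point : ∀ p : ℝ × ℝ, p ∉ Set.range vpos →
    ∀ u₁ v₁ u₂ v₂ u₃ v₃, G.Adj u₁ v₁ → G.Adj u₂ v₂ → G.Adj u₃ v₃ →
      s(u₁, v₁) ≠ s(u₂, v₂) → s(u₁, v₁) ≠ s(u₃, v₃) → s(u₂, v₂) ≠ s(u₃, v₃) →
      ¬ (p ∈ arc u₁ v₁ '' Set.Icc 0 1 ∧ p ∈ arc u₂ v₂ '' Set.Icc 0 1 ∧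
          p ∈ arc u₃ v₃ '' Set.Icc 0 1)

namespace Drawing

variable {V : Type} {G : SimpleGraph V}

lemma img_symm_aux (Γ : Drawing G) (u v : V) :
    Γ.arc u v '' Set.Icc 0 1 = Γ.arc v u '' Set.Icc 0 1 := by
  have key : ∀ a b : V, Γ.arc a b '' Set.Icc 0 1 ⊆ Γ.arc b a '' Set.Icc 0 1 := by
    rintro a b p ⟨t, ht, rfl⟩
    refine ⟨1 - t, ⟨by linarith [ht.2], by linarith [ht.1]⟩, ?_⟩
    rw [Γ.arc_symm b a (1 - t)]
    congr 1
    ring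
  exact Set.Subset.antisymm (key u v) (key v u)

/-- The image (trace) of an edge in the drawing. -/
def img (Γ : Drawing G) (e : Sym2 V) : Set (ℝ × ℝ) :=
  Sym2.lift ⟨fun u v => Γ.arc u v '' Set.Icc 0 1, fun u v => Γ.img_symm_aux u v⟩ e

/-- `p` is a crossing point of the two distinct edges `e` and `f` : it lies on
both arcs and is not the image of a vertex (so it is not a shared endpoint). -/
def Crossing (Γ : Drawing G) (e f : Sym2 V) (p : ℝ × ℝ) : Prop :=
  e ∈ G.edgeSet ∧ f ∈ G.edgeSet ∧ e ≠ f ∧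
    p ∈ Γ.img e ∧ p ∈ Γ.img f ∧ p ∉ Set.range Γ.vpos

/-- The edges `e` and `f` cross in the drawing. -/
def Crosses (Γ : Drawing G) (e f : Sym2 V) : Prop := ∃ p, Γ.Crossing e f p

/-- The set of crossing points of a drawing. -/
def crossingSet (Γ : Drawing G) : Set (ℝ × ℝ) := {p | ∃ e f, Γ.Crossing e f p}

/-- The number of crossings of a drawing. -/
def crossings (Γ : Drawing G) : ℕ := Γ.crossingSet.ncard

/-- The set of crossing points lying on a given edge. -/
def edgeCrossings (Γ : Drawing G) (e : Sym2 V) : Set (ℝ × ℝ) :=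
  {p | ∃ f, Γ.Crossing e f p}

/-- A drawing is `k`-planar if every edge is involved in at most `k` crossings. -/
def IsKPlanar (Γ : Drawing G) (k : ℕ) : Prop :=
  ∀ e ∈ G.edgeSet, (Γ.edgeCrossings e).ncard ≤ k

/-- A drawing is `k`-gap-planar if each crossing can be assigned to one of its
two involved edges such that every edge is assigned at most `k` crossings. -/
def IsKGapPlanar (Γ : Drawing G) (k : ℕ) : Prop :=
  ∃ assign : ℝ × ℝ → Sym2 V,
    (∀ p ∈ Γ.crossingSet, ∃ f, Γ.Crossing (assign p) f p) ∧
    ∀ e : Sym2 V, {p | p ∈ Γ.crossingSet ∧ assign p = e}.ncard ≤ k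

/-- A drawing is skewness-`k` if there is a set of at most `k` edges such that
every crossing involves an edge from the set. -/
def IsSkewness (Γ : Drawing G) (k : ℕ) : Prop :=
  ∃ S : Finset (Sym2 V), S.card ≤ k ∧
    ∀ p ∈ Γ.crossingSet, ∃ e ∈ S, ∃ f, Γ.Crossing e f p

/-- A drawing is `k`-apex if there is a set of at most `k` vertices such that
every crossing involves an edge incident to one of these vertices. -/
def IsKApex (Γ : Drawing G) (k : ℕ) : Prop :=
  ∃ S : Finset V, S.card ≤ k ∧
    ∀ p ∈ Γ.crossingSet, ∃ e f, Γ.Crossing e f p ∧ ∃ a ∈ S, a ∈ e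

/-- A drawing is `(k,l)`-grid-free if there is no set of `k` edges each of
which crosses each edge of some set of `l` edges. -/
def IsGridFree (Γ : Drawing G) (k l : ℕ) : Prop :=
  ¬ ∃ A B : Finset (Sym2 V), A.card = k ∧ B.card = l ∧
      ∀ e ∈ A, ∀ f ∈ B, Γ.Crosses e f

/-- A drawing is `k`-fan-crossing-free if no edge crosses `k` edges that all
share a common endpoint. -/
def IsKFanCrossingFree (Γ : Drawing G) (k : ℕ) : Prop :=
  ¬ ∃ (e : Sym2 V) (a : V) (F : Finset (Sym2 V)), F.card = k ∧
      ∀ f ∈ F, a ∈ f ∧ Γ.Crosses e f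

/-- A drawing is planarly connected if for any two crossing edges, two of
their endpoints are joined by a crossing-free edge. -/
def IsPlanarlyConnected (Γ : Drawing G) : Prop :=
  ∀ e f : Sym2 V, Γ.Crosses e f →
    ∃ a b : V, a ∈ e ∧ b ∈ f ∧ G.Adj a b ∧ Γ.edgeCrossings s(a, b) = ∅

/-- A drawing is straight-line if every edge is drawn as the line segment
between the images of its endpoints. -/
def IsStraight (Γ : Drawing G) : Prop :=
  ∀ u v : V, G.Adj u v → ∀ t ∈ Set.Icc (0:ℝ) 1,
    Γ.arc u v t = (1 - t) • Γ.vpos u + t • Γ.vpos v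

/-- A straight-line RAC drawing: straight-line and any two crossing edges are
perpendicular. -/
def IsRAC (Γ : Drawing G) : Prop :=
  Γ.IsStraight ∧
    ∀ u v w z : V, G.Adj u v → G.Adj w z → Γ.Crosses s(u, v) s(w, z) →
      (Γ.vpos v - Γ.vpos u).1 * (Γ.vpos z - Γ.vpos w).1 +
        (Γ.vpos v - Γ.vpos u).2 * (Γ.vpos z - Γ.vpos w).2 = 0

end Drawing

/-- The crossing number of `G`: the minimum number of crossings over all
drawings of `G`. -/
def crNum {V : Type} (G : SimpleGraph V) : ℕ :=
  sInf {n | ∃ Γ : Drawing G, Γ.crossings = n}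

/-- The crossing number of `G` restricted to drawings satisfying `P`. -/
def crNumRestricted {V : Type} (G : SimpleGraph V) (P : Drawing G → Prop) : ℕ :=
  sInf {n | ∃ Γ : Drawing G, P Γ ∧ Γ.crossings = n}

/-- The rectilinear crossing number of `G`. -/
def rectCrNum {V : Type} (G : SimpleGraph V) : ℕ :=
  crNumRestricted G (fun Γ => Γ.IsStraight)

/-- An ℓ₂-bundle between `x` and `y`: `P` is the set of the internal vertices
of ℓ internally disjoint paths of length two from `x` to `y`, all of whose
internal vertices have degree exactly two in `G` (here ℓ = `P.card`). -/
def IsL2Bundle {V : Type} (G : SimpleGraph V) (x y : V) (P : Finset V) : Prop :=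
  x ≠ y ∧ x ∉ P ∧ y ∉ P ∧
    ∀ p ∈ P, G.Adj x p ∧ G.Adj p y ∧ (G.neighborSet p).ncard = 2

/-- Two drawings of `G` are weakly isomorphic: there is an incidence-preserving
one-to-one correspondence of vertices and edges that preserves crossings. -/
def WeaklyIso {V : Type} {G : SimpleGraph V} (Γ Γ' : Drawing G) : Prop :=
  ∃ φ : G ≃g G, ∀ e f : Sym2 V,
    Γ.Crosses e f ↔ Γ'.Crosses (Sym2.map (fun a => φ a) e) (Sym2.map (fun a => φ a) f)

/-- A nowhere vanishing continuous function on a simply connected space has a continuous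
logarithm. -/
lemma exists_continuous_log {A : Type*} [TopologicalSpace A] [SimplyConnectedSpace A]
    [LocallyPathConnectedSpace A] {f : A → ℂ} (hf : Continuous f) (h0 : ∀ a, f a ≠ 0) :
    ∃ g : A → ℂ, Continuous g ∧ ∀ a, Complex.exp (g a) = f a := by
  obtain ⟨a₀⟩ : Nonempty A := inferInstance
  obtain ⟨F, ⟨-, hF⟩, -⟩ := Complex.isCoveringMapOn_exp.existsUnique_continuousMap_lifts
    ⟨f, hf⟩ (a₀ := a₀) (Complex.exp_log (h0 a₀)) h0
  exact ⟨F, F.continuous, fun a => congrFun hF a⟩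

/-- Two continuous logarithms of proportional functions have the same increment. -/
lemma log_increment_eq {f g : ℝ → ℂ} (hf : Continuous f) (hg : Continuous g) (c : ℂ)
    (h : ∀ t, Complex.exp (f t) = c * Complex.exp (g t)) : f 1 - f 0 = g 1 - g 0 := by
  have hc : ∀ t, Complex.exp (f t - g t) = c := fun t => by
    rw [Complex.exp_sub, h, mul_div_assoc, div_self (Complex.exp_ne_zero _), mul_one]
  have hc0 : c ≠ 0 := hc 0 ▸ Complex.exp_ne_zero _
  have key := (Complex.isCoveringMapOn_exp.existsUnique_continuousMap_lifts
    (ContinuousMap.const ℝ c) (a₀ := 0) (hc 0) (fun _ => hc0)).unique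
    (y₁ := ⟨fun t => f t - g t, hf.sub hg⟩) (y₂ := ContinuousMap.const ℝ (f 0 - g 0))
    ⟨rfl, funext hc⟩ ⟨rfl, funext fun _ => hc 0⟩
  have h1 : f 1 - g 1 = f 0 - g 0 := congrArg (fun F : C(ℝ, ℂ) => F 1) key
  linear_combination h1

/-- A system of integer equations that is inconsistent modulo two: the van Kampen obstruction of
`K₃,₃`. -/
lemma vanKampen_obstruction (n m : Fin 3 → Fin 3 → Fin 3 → ℤ)
    (h : ∀ i i' j j', i < i' → j ≠ j' →
      n i i' j' + m j' i j - m j i' j' - n i' i j + (if j < j' then 1 else 0) = 0) : False := by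
  have h' : ∀ i i', i < i' → (∀ j j', j ≠ j' → _) := fun i i' hi j j' hj => h i i' j j' hi hj
  have e := fun i i' hi => And.intro (h' i i' hi 0 1 (by decide)) <|
    And.intro (h' i i' hi 0 2 (by decide)) <| And.intro (h' i i' hi 1 0 (by decide)) <|
    And.intro (h' i i' hi 1 2 (by decide)) <| And.intro (h' i i' hi 2 0 (by decide))
      (h' i i' hi 2 1 (by decide))
  have e01 := e 0 1 (by decide)
  have e02 := e 0 2 (by decide)
  have e12 := e 1 2 (by decide)
  simp at e01 e02 e12
  omega

/-- Every continuous drawing of `K₃,₃` in the plane has two independent edges that meet. -/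
theorem exists_independent_edges_meet (A B : Fin 3 → ℂ) (γ : Fin 3 → Fin 3 → ℝ → ℂ)
    (hγ : ∀ i j, Continuous (γ i j)) (h0 : ∀ i j, γ i j 0 = A i) (h1 : ∀ i j, γ i j 1 = B j) :
    ∃ i i' j j' s t, i < i' ∧ j ≠ j' ∧ γ i j s = γ i' j' t := by
  by_contra! H
  replace H : ∀ i i' j j', i ≠ i' → j ≠ j' → ∀ s t, γ i j s - γ i' j' t ≠ 0 := by
    intro i i' j j' hi hj s t
    rw [sub_ne_zero]
    rcases lt_or_gt_of_ne hi with hi | hi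
    · exact H _ _ _ _ _ _ hi hj
    · exact (H _ _ _ _ _ _ hi hj.symm).symm
  have other : ∀ i : Fin 3, ∃ i', i' ≠ i := by decide
  have hAγ : ∀ i i' j', i ≠ i' → ∀ t, A i - γ i' j' t ≠ 0 := fun i i' j' hi t => by
    obtain ⟨j, hj⟩ := other j'
    simpa [h0] using H i i' j j' hi hj 0 t
  have hBγ : ∀ j i' j', j ≠ j' → ∀ t, B j - γ i' j' t ≠ 0 := fun j i' j' hj t => by
    obtain ⟨i, hi⟩ := other i'
    simpa [h1] using H i i' j j' hi hj 1 t
  have hAA : ∀ i i', i ≠ i' → A i - A i' ≠ 0 := fun i i' hi => by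
    simpa [h0] using hAγ i i' 0 hi 0
  have hBB : ∀ j j', j ≠ j' → B j - B j' ≠ 0 := fun j j' hj => by
    simpa [h1] using hBγ j 0 j' hj 1
  have hAB : ∀ i j, A i - B j ≠ 0 := fun i j => by
    obtain ⟨i', hi⟩ := other i
    simpa [h1] using hAγ i i' j hi.symm 1
  have exA : ∀ i i' j', ∃ l : ℝ → ℂ, i ≠ i' →
      Continuous l ∧ ∀ t, Complex.exp (l t) = A i - γ i' j' t := fun i i' j' => by
    by_cases hi : i = i'
    · exact ⟨0, fun h => (h hi).elim⟩
    · obtain ⟨l, hl⟩ := exists_continuous_log (continuous_const.sub (hγ i' j')) (hAγ i i' j' hi)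
      exact ⟨l, fun _ => hl⟩
  have exB : ∀ j i' j', ∃ l : ℝ → ℂ, j ≠ j' →
      Continuous l ∧ ∀ t, Complex.exp (l t) = B j - γ i' j' t := fun j i' j' => by
    by_cases hj : j = j'
    · exact ⟨0, fun h => (h hj).elim⟩
    · obtain ⟨l, hl⟩ := exists_continuous_log (continuous_const.sub (hγ i' j')) (hBγ j i' j' hj)
      exact ⟨l, fun _ => hl⟩
  choose α hα using exA
  choose β hβ using exB
  have square : ∀ i i' j j', i ≠ i' → j ≠ j' →
      (α i i' j' 1 - α i i' j' 0) + (β j' i j 1 - β j' i j 0) - (β j i' j' 1 - β j i' j' 0)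
        - (α i' i j 1 - α i' i j 0) = 0 := by
    intro i i' j j' hi hj
    obtain ⟨L, hL, hexp⟩ := exists_continuous_log (A := ℝ × ℝ)
      (f := fun x => γ i j x.1 - γ i' j' x.2)
      (((hγ i j).comp continuous_fst).sub ((hγ i' j').comp continuous_snd))
      (fun x => H i i' j j' hi hj x.1 x.2)
    have e1 := log_increment_eq (f := fun t => L (0, t)) (by fun_prop) (hα i i' j' hi).1 1
      (fun t => by rw [hexp, (hα i i' j' hi).2, h0]; ring)
    have e2 := log_increment_eq (f := fun t => L (t, 1)) (by fun_prop) (hβ j' i j hj.symm).1 (-1)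
      (fun t => by rw [hexp, (hβ j' i j hj.symm).2, h1]; ring)
    have e3 := log_increment_eq (f := fun t => L (1, t)) (by fun_prop) (hβ j i' j' hj).1 1
      (fun t => by rw [hexp, (hβ j i' j' hj).2, h1]; ring)
    have e4 := log_increment_eq (f := fun t => L (t, 0)) (by fun_prop) (hα i' i j hi.symm).1 (-1)
      (fun t => by rw [hexp, (hα i' i j hi.symm).2, h0]; ring)
    linear_combination -e1 - e2 + e3 + e4
  let lg : (Fin 3 → ℂ) → Fin 3 → Fin 3 → ℂ := fun C i i' =>
    if i < i' then Complex.log (C i - C i') else Complex.log (C i' - C i) + Real.pi * Complex.I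
  have hlg : ∀ C : Fin 3 → ℂ, (∀ i i', i ≠ i' → C i - C i' ≠ 0) →
      ∀ i i', i ≠ i' → Complex.exp (lg C i i') = C i - C i' := by
    intro C hC i i' hi
    by_cases hlt : i < i'
    · simp [lg, hlt, Complex.exp_log (hC i i' hi)]
    · simp [lg, hlt, Complex.exp_add, Complex.exp_log (hC i' i hi.symm)]
  have exn : ∀ i i' j', ∃ n : ℤ, i ≠ i' → α i i' j' 1 - α i i' j' 0 =
      Complex.log (A i - B j') - lg A i i' + n * (2 * Real.pi * Complex.I) := fun i i' j' => by
    by_cases hi : i = i'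
    · exact ⟨0, fun h => (h hi).elim⟩
    · obtain ⟨n, hn⟩ := Complex.exp_eq_exp_iff_exists_int.1
        (show Complex.exp (α i i' j' 1 - α i i' j' 0) =
          Complex.exp (Complex.log (A i - B j') - lg A i i') by
          rw [Complex.exp_sub, Complex.exp_sub, (hα i i' j' hi).2, (hα i i' j' hi).2,
            Complex.exp_log (hAB i j'), hlg A hAA i i' hi, h0, h1])
      exact ⟨n, fun _ => hn⟩
  have exm : ∀ j i' j', ∃ m : ℤ, j ≠ j' → β j i' j' 1 - β j i' j' 0 =
      lg B j j' - (Complex.log (A i' - B j) + Real.pi * Complex.I)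
        + m * (2 * Real.pi * Complex.I) := fun j i' j' => by
    by_cases hj : j = j'
    · exact ⟨0, fun h => (h hj).elim⟩
    · obtain ⟨n, hn⟩ := Complex.exp_eq_exp_iff_exists_int.1
        (show Complex.exp (β j i' j' 1 - β j i' j' 0) =
          Complex.exp (lg B j j' - (Complex.log (A i' - B j) + Real.pi * Complex.I)) by
          rw [Complex.exp_sub, Complex.exp_sub, (hβ j i' j' hj).2, (hβ j i' j' hj).2,
            Complex.exp_add, Complex.exp_log (hAB i' j), hlg B hBB j j' hj, h0, h1,
            Complex.exp_pi_mul_I]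
          congr 1
          ring)
      exact ⟨n, fun _ => hn⟩
  choose n hn using exn
  choose m hm using exm
  refine vanKampen_obstruction n m fun i i' j j' hi hj => ?_
  have e := square i i' j j' hi.ne hj
  rw [hn i i' j' hi.ne, hm j' i j hj.symm, hm j i' j' hj, hn i' i j hi.ne'] at e
  have hA : lg A i' i - lg A i i' = Real.pi * Complex.I := by simp [lg, hi, hi.not_gt]
  have hB : lg B j' j - lg B j j' =
      (2 * (if j < j' then (1 : ℤ) else 0) - 1 : ℤ) * (Real.pi * Complex.I) := by
    rcases lt_or_gt_of_ne hj with hlt | hlt <;> simp [lg, hlt, hlt.not_gt]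
  have key : ((n i i' j' + m j' i j - m j i' j' - n i' i j + (if j < j' then 1 else 0) : ℤ) : ℂ)
      * (2 * Real.pi * Complex.I) = 0 := by
    push_cast at hB ⊢
    linear_combination e - hA - hB
  rcases mul_eq_zero.1 key with h | h
  · exact_mod_cast h
  · exact (Complex.two_pi_I_ne_zero h).elim

/-- The simple graph with the given edges, indexed by `ι`. -/
def edgeGraph {V ι : Type} (src dst : ι → V) : SimpleGraph V :=
  SimpleGraph.fromEdgeSet (range fun e => s(src e, dst e))

lemma edgeGraph_adj {V ι : Type} {src dst : ι → V} {u v : V} :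
    (edgeGraph src dst).Adj u v ↔ (∃ e, s(src e, dst e) = s(u, v)) ∧ u ≠ v := by
  simp [edgeGraph]

lemma segment_eq_of_edge_eq {V E : Type} [AddCommGroup E] [Module ℝ E] (pos : V → E)
    {u v w z : V} (h : s(u, v) = s(w, z)) :
    segment ℝ (pos u) (pos v) = segment ℝ (pos w) (pos z) := by
  rcases Sym2.eq_iff.1 h with ⟨rfl, rfl⟩ | ⟨rfl, rfl⟩
  · rfl
  · exact segment_symm ..

/-- The straight-line drawing with prescribed vertex positions. -/
def straightDrawing {V ι : Type} {src dst : ι → V} (pos : V → ℝ × ℝ)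
    (pos_inj : Function.Injective pos)
    (avoids : ∀ e w, w ≠ src e → w ≠ dst e → pos w ∉ segment ℝ (pos (src e)) (pos (dst e)))
    (finite : ∀ e f, e ≠ f →
      (segment ℝ (pos (src e)) (pos (dst e)) ∩ segment ℝ (pos (src f)) (pos (dst f))).Finite)
    (no_triple : ∀ p ∉ range pos, ∀ e f g, e ≠ f → e ≠ g → f ≠ g →
      p ∈ segment ℝ (pos (src e)) (pos (dst e)) → p ∈ segment ℝ (pos (src f)) (pos (dst f)) →
      p ∉ segment ℝ (pos (src g)) (pos (dst g))) :
    Drawing (edgeGraph src dst) where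
  vpos := pos
  vpos_inj := pos_inj
  arc u v := AffineMap.lineMap (pos u) (pos v)
  arc_symm u v t := (AffineMap.lineMap_apply_one_sub ..).symm
  arc_cont u v _ := AffineMap.lineMap_continuous.continuousOn
  arc_injOn u v h := (AffineMap.lineMap_injective ℝ (pos_inj.ne h.ne)).injOn
  arc_start u v _ := AffineMap.lineMap_apply_zero ..
  arc_end u v _ := AffineMap.lineMap_apply_one ..
  arc_avoids u v h t ht := by
    rintro ⟨w, hw⟩
    have hinj := AffineMap.lineMap_injective ℝ (pos_inj.ne h.ne)
    obtain ⟨⟨e, he⟩, -⟩ := edgeGraph_adj.1 h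
    have hwe : w ∉ s(u, v) := by
      rw [Sym2.mem_iff]
      rintro (rfl | rfl)
      · exact ht.1.ne (hinj ((AffineMap.lineMap_apply_zero ..).trans hw))
      · exact ht.2.ne' (hinj ((AffineMap.lineMap_apply_one ..).trans hw))
    rw [← he, Sym2.mem_iff, not_or] at hwe
    refine avoids e w hwe.1 hwe.2 ?_
    rw [segment_eq_of_edge_eq pos he, segment_eq_image_lineMap, hw]
    exact mem_image_of_mem _ (Ioo_subset_Icc_self ht)
  inter_finite u v w z h h' hne := by
    obtain ⟨⟨e, he⟩, -⟩ := edgeGraph_adj.1 h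
    obtain ⟨⟨f, hf⟩, -⟩ := edgeGraph_adj.1 h'
    rw [← segment_eq_image_lineMap, ← segment_eq_image_lineMap, ← segment_eq_of_edge_eq pos he,
      ← segment_eq_of_edge_eq pos hf]
    refine finite e f ?_
    rintro rfl
    exact hne (he.symm.trans hf)
  no_triple_point p hp u₁ v₁ u₂ v₂ u₃ v₃ h₁ h₂ h₃ h12 h13 h23 := by
    obtain ⟨⟨e, he⟩, -⟩ := edgeGraph_adj.1 h₁
    obtain ⟨⟨f, hf⟩, -⟩ := edgeGraph_adj.1 h₂
    obtain ⟨⟨g, hg⟩, -⟩ := edgeGraph_adj.1 h₃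
    rintro ⟨m1, m2, m3⟩
    rw [← segment_eq_image_lineMap, ← segment_eq_of_edge_eq pos he] at m1
    rw [← segment_eq_image_lineMap, ← segment_eq_of_edge_eq pos hf] at m2
    rw [← segment_eq_image_lineMap, ← segment_eq_of_edge_eq pos hg] at m3
    refine no_triple p hp e f g ?_ ?_ ?_ m1 m2 m3
    · rintro rfl
      exact h12 (he.symm.trans hf)
    · rintro rfl
      exact h13 (he.symm.trans hg)
    · rintro rfl
      exact h23 (hf.symm.trans hg)

lemma straightDrawing_crossing {V ι : Type} {src dst : ι → V} {pos : V → ℝ × ℝ} {pos_inj}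
    {avoids} {finite} {no_triple} {a b : Sym2 V} {p : ℝ × ℝ}
    (h : (straightDrawing (src := src) (dst := dst) pos pos_inj avoids finite no_triple).Crossing
      a b p) :
    ∃ e f, a = s(src e, dst e) ∧ b = s(src f, dst f) ∧ e ≠ f ∧
      p ∈ segment ℝ (pos (src e)) (pos (dst e)) ∧ p ∈ segment ℝ (pos (src f)) (pos (dst f)) ∧
      p ∉ range pos := by
  obtain ⟨ha, hb, hne, pa, pb, hp⟩ := h
  simp only [edgeGraph, SimpleGraph.edgeSet_fromEdgeSet] at ha hb
  obtain ⟨⟨e, rfl⟩, -⟩ := ha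
  obtain ⟨⟨f, rfl⟩, -⟩ := hb
  refine ⟨e, f, rfl, rfl, ?_, ?_, ?_, hp⟩
  · rintro rfl
    exact hne rfl
  · rw [segment_eq_image_lineMap]
    exact pa
  · rw [segment_eq_image_lineMap]
    exact pb

/-- Transport of a drawing along a graph isomorphism. -/
def Drawing.comap {V U : Type} {G : SimpleGraph V} {H : SimpleGraph U} (Γ : Drawing G)
    (φ : H ≃g G) : Drawing H where
  vpos u := Γ.vpos (φ u)
  vpos_inj := Γ.vpos_inj.comp φ.injective
  arc u v := Γ.arc (φ u) (φ v)
  arc_symm _ _ := Γ.arc_symm _ _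
  arc_cont _ _ h := Γ.arc_cont _ _ (φ.map_adj_iff.2 h)
  arc_injOn _ _ h := Γ.arc_injOn _ _ (φ.map_adj_iff.2 h)
  arc_start _ _ h := Γ.arc_start _ _ (φ.map_adj_iff.2 h)
  arc_end _ _ h := Γ.arc_end _ _ (φ.map_adj_iff.2 h)
  arc_avoids _ _ h t ht := by
    rintro ⟨w, hw⟩
    exact Γ.arc_avoids _ _ (φ.map_adj_iff.2 h) t ht ⟨φ w, hw⟩
  inter_finite u v w z h h' hne := Γ.inter_finite _ _ _ _ (φ.map_adj_iff.2 h)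
    (φ.map_adj_iff.2 h') fun e => hne (Sym2.map.injective φ.injective e)
  no_triple_point p hp u₁ v₁ u₂ v₂ u₃ v₃ h₁ h₂ h₃ h12 h13 h23 := by
    refine Γ.no_triple_point p ?_ _ _ _ _ _ _ (φ.map_adj_iff.2 h₁) (φ.map_adj_iff.2 h₂)
      (φ.map_adj_iff.2 h₃) (fun e => h12 (Sym2.map.injective φ.injective e))
      (fun e => h13 (Sym2.map.injective φ.injective e))
      (fun e => h23 (Sym2.map.injective φ.injective e))
    rintro ⟨v, rfl⟩
    exact hp ⟨φ.symm v, by simp⟩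

namespace Drawing

variable {V U : Type} {G : SimpleGraph V} {H : SimpleGraph U}

lemma comap_crossing (Γ : Drawing G) (φ : H ≃g G) (e f : Sym2 U) (p : ℝ × ℝ) :
    (Γ.comap φ).Crossing e f p ↔ Γ.Crossing (e.map φ) (f.map φ) p := by
  have himg : ∀ e : Sym2 U, (Γ.comap φ).img e = Γ.img (e.map φ) := by
    rintro ⟨u, v⟩
    rfl
  have hedge : ∀ e : Sym2 U, e.map φ ∈ G.edgeSet ↔ e ∈ H.edgeSet := by
    rintro ⟨u, v⟩
    exact φ.map_adj_iff
  have hrange : range (Γ.comap φ).vpos = range Γ.vpos := φ.surjective.range_comp Γ.vpos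
  rw [Crossing, Crossing, himg, himg, hedge, hedge, hrange,
    (Sym2.map.injective φ.injective).ne_iff]

lemma map_symm_map (φ : H ≃g G) (e : Sym2 V) : (e.map φ.symm).map φ = e := by
  rw [Sym2.map_map]
  have : (φ ∘ φ.symm : V → V) = id := by
    ext
    simp
  rw [this, Sym2.map_id, id]

lemma comap_crossings (Γ : Drawing G) (φ : H ≃g G) : (Γ.comap φ).crossings = Γ.crossings := by
  have : (Γ.comap φ).crossingSet = Γ.crossingSet := by
    ext p
    constructor
    · rintro ⟨e, f, h⟩
      exact ⟨_, _, (Γ.comap_crossing φ e f p).1 h⟩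
    · rintro ⟨e, f, h⟩
      refine ⟨e.map φ.symm, f.map φ.symm, (Γ.comap_crossing φ _ _ p).2 ?_⟩
      rwa [map_symm_map, map_symm_map]
  rw [crossings, crossings, this]

lemma IsKApex.comap {Γ : Drawing G} {k : ℕ} (hΓ : Γ.IsKApex k) (φ : H ≃g G) :
    (Γ.comap φ).IsKApex k := by
  obtain ⟨S, hS, h⟩ := hΓ
  refine ⟨S.map φ.symm.toEquiv.toEmbedding, by simpa using hS, ?_⟩
  rintro p ⟨e, f, hc⟩
  obtain ⟨e', f', hc', a, ha, hae⟩ := h p ⟨_, _, (Γ.comap_crossing φ e f p).1 hc⟩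
  refine ⟨e'.map φ.symm, f'.map φ.symm, (Γ.comap_crossing φ _ _ p).2 ?_, φ.symm a,
    Finset.mem_map_of_mem _ ha, Sym2.mem_map.2 ⟨a, hae, rfl⟩⟩
  rwa [map_symm_map, map_symm_map]

lemma crossingSet_finite [Finite V] (Γ : Drawing G) : Γ.crossingSet.Finite := by
  have : Γ.crossingSet ⊆ ⋃ x ∈ {x : Sym2 V × Sym2 V | x.1 ∈ G.edgeSet ∧ x.2 ∈ G.edgeSet ∧
      x.1 ≠ x.2}, Γ.img x.1 ∩ Γ.img x.2 := by
    rintro p ⟨e, f, he, hf, hne, pe, pf, -⟩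
    exact mem_biUnion (x := (e, f)) ⟨he, hf, hne⟩ ⟨pe, pf⟩
  refine (Set.Finite.biUnion (Set.toFinite _) ?_).subset this
  rintro ⟨⟨u, v⟩, ⟨w, z⟩⟩ ⟨he, hf, hne⟩
  exact Γ.inter_finite u v w z he hf hne

lemma Crossing.edges_eq {Γ : Drawing G} {e f e' f' : Sym2 V} {p : ℝ × ℝ}
    (h : Γ.Crossing e f p) (h' : Γ.Crossing e' f' p) : s(e, f) = s(e', f') := by
  obtain ⟨he, hf, hne, pe, pf, hp⟩ := h
  obtain ⟨he', hf', hne', pe', pf', -⟩ := h'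
  have key : ∀ a : Sym2 V, a ∈ G.edgeSet → p ∈ Γ.img a → a = e ∨ a = f := by
    intro a ha pa
    by_contra! hcon
    induction e, f using Sym2.inductionOn₂ with | _ u v w z =>
    induction a with | _ x y =>
    exact Γ.no_triple_point p hp u v w z x y he hf ha hne hcon.1.symm hcon.2.symm ⟨pe, pf, pa⟩
  rcases key e' he' pe' with rfl | rfl <;> rcases key f' hf' pf' with rfl | rfl
  · exact (hne' rfl).elim
  · rfl
  · exact Sym2.eq_swap
  · exact (hne' rfl).elim

end Drawing

/-- The vertices other than the hub of a copy of `K₃,₃` in which every edge at one vertex, the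
hub, is replaced by `h` paths of length two: the midpoints of these paths, the ports (the side of
the bipartition opposite to the hub) and the poles (the two vertices on the side of the hub). -/
abbrev SideVertex (h : ℕ) : Type := (Fin 3 × Fin h) ⊕ Fin 3 ⊕ Bool

/-- The hub. -/
abbrev hub {h : ℕ} : Option (SideVertex h) := none

/-- The midpoint of the `i`-th path between the hub and the `j`-th port. -/
abbrev mid {h : ℕ} (j : Fin 3) (i : Fin h) : Option (SideVertex h) := some (Sum.inl (j, i))

/-- The `j`-th port. -/
abbrev port {h : ℕ} (j : Fin 3) : Option (SideVertex h) := some (Sum.inr (Sum.inl j))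

/-- One of the two poles. -/
abbrev pole {h : ℕ} (b : Bool) : Option (SideVertex h) := some (Sum.inr (Sum.inr b))

/-- The edges of `K₃,₃` with thickened edges at the hub. -/
inductive SideEdge (h : ℕ) : Type
  | hubMid (j : Fin 3) (i : Fin h)
  | midPort (j : Fin 3) (i : Fin h)
  | polePort (b : Bool) (j : Fin 3)

namespace SideEdge

/-- The first end of an edge. -/
def src {h : ℕ} : SideEdge h → Option (SideVertex h)
  | hubMid _ _ => hub
  | midPort j i => mid j i
  | polePort b _ => pole b

/-- The second end of an edge, which is never the hub. -/
def tgt {h : ℕ} : SideEdge h → SideVertex h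
  | hubMid j i => Sum.inl (j, i)
  | midPort j _ => Sum.inr (Sum.inl j)
  | polePort _ j => Sum.inr (Sum.inl j)

/-- The second end of an edge. -/
def dst {h : ℕ} (e : SideEdge h) : Option (SideVertex h) := some e.tgt

/-- The line segment representing an edge. -/
def seg {h : ℕ} (loc : Option (SideVertex h) → ℝ × ℝ) (e : SideEdge h) : Set (ℝ × ℝ) :=
  segment ℝ (loc e.src) (loc e.dst)

end SideEdge

/-- The vertices of the disjoint union of `m` isolated vertices and of `k` graphs, each of which
consists of two thickened `K₃,₃` with a common hub. -/
abbrev Vtx (k h m : ℕ) : Type := Fin m ⊕ Fin k × Option (Bool × SideVertex h)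

/-- The edges, indexed by the component, the side, and the edge of the thickened `K₃,₃`. -/
abbrev Edg (k h : ℕ) : Type := Fin k × Bool × SideEdge h

section

variable {k h m : ℕ}

/-- The embedding of a thickened `K₃,₃`. -/
def emb (m : ℕ) (c : Fin k) (s : Bool) (w : Option (SideVertex h)) : Vtx k h m :=
  Sum.inr (c, w.map (Prod.mk s))

/-- The first end of an edge. -/
def esrc (m : ℕ) (e : Edg k h) : Vtx k h m := emb m e.1 e.2.1 e.2.2.src

/-- The second end of an edge. -/
def edst (m : ℕ) (e : Edg k h) : Vtx k h m := emb m e.1 e.2.1 e.2.2.dst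

/-- The disjoint union of `m` isolated vertices and of `k` graphs, each of which consists of two
thickened `K₃,₃` with a common hub. -/
def hubGraph (k h m : ℕ) : SimpleGraph (Vtx k h m) := edgeGraph (ι := Edg k h) (esrc m) (edst m)

lemma emb_injective (c : Fin k) (s : Bool) :
    Function.Injective (emb m c s : Option (SideVertex h) → Vtx k h m) := by
  intro w w' hw
  simpa [emb, (Option.map_injective (Prod.mk_right_injective s)).eq_iff] using hw

lemma emb_eq_emb {c c' : Fin k} {s s' : Bool} {w w' : Option (SideVertex h)}
    (e : emb m c s w = emb m c' s' w') : c = c' ∧ w = w' ∧ (s = s' ∨ w = none) := by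
  cases w <;> cases w' <;> simp_all [emb]

lemma src_ne_dst (e : SideEdge h) : e.src ≠ e.dst := by
  cases e <;> simp [SideEdge.src, SideEdge.dst, SideEdge.tgt]

/-- A straight-line drawing of a thickened `K₃,₃` inside a half-strip, the hub being the only
vertex on the boundary. -/
structure Layout (h : ℕ) where
  loc : Option (SideVertex h) → ℝ × ℝ
  loc_hub : loc none = 0
  x_pos : ∀ w, 0 < (loc (some w)).1
  y_bound : ∀ w, |(loc (some w)).2| < 5
  inj : Function.Injective loc
  avoids : ∀ (e : SideEdge h) w, w ≠ e.src → w ≠ e.dst → loc w ∉ e.seg loc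
  finite : ∀ e f : SideEdge h, e ≠ f → (e.seg loc ∩ f.seg loc).Finite
  no_triple : ∀ p ∉ range loc, ∀ e f g : SideEdge h, e ≠ f → e ≠ g → f ≠ g →
    p ∈ e.seg loc → p ∈ f.seg loc → p ∉ g.seg loc

/-- The affine transformation that moves the half-strip to its place. -/
def place (c : ℕ) (s : Bool) : ℝ × ℝ → ℝ × ℝ :=
  fun p => ((if s then 1 else -1) * p.1, p.2 + 10 * c)

lemma place_injective (c : ℕ) (s : Bool) : Function.Injective (place c s) := by
  intro p q hpq
  cases s <;> simp [place] at hpq <;> exact Prod.ext hpq.1 hpq.2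

lemma mem_segment_prod {a b p : ℝ × ℝ} : p ∈ segment ℝ a b ↔
    ∃ t, 0 ≤ t ∧ t ≤ 1 ∧ p.1 = (1 - t) * a.1 + t * b.1 ∧ p.2 = (1 - t) * a.2 + t * b.2 := by
  rw [segment_eq_image]
  constructor
  · rintro ⟨t, ht, rfl⟩
    exact ⟨t, ht.1, ht.2, by simp, by simp⟩
  · rintro ⟨t, h0, h1, hx, hy⟩
    exact ⟨t, ⟨h0, h1⟩, Prod.ext (by simp [hx]) (by simp [hy])⟩

lemma segment_place (c : ℕ) (s : Bool) (a b : ℝ × ℝ) :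
    segment ℝ (place c s a) (place c s b) = place c s '' segment ℝ a b := by
  rw [segment_eq_image, segment_eq_image, image_image]
  refine image_congr fun t _ => ?_
  cases s <;> ext <;> simp [place] <;> ring

namespace Layout

variable (L : Layout h)

/-- The position of a vertex in the union of the placed half-strips. -/
def pos (k m : ℕ) : Vtx k h m → ℝ × ℝ
  | Sum.inl r => (0, 10 * (k + r : ℕ))
  | Sum.inr (c, none) => (0, 10 * (c : ℕ))
  | Sum.inr (c, some (s, w)) => place c s (L.loc (some w))

lemma pos_emb (c : Fin k) (s : Bool) (w : Option (SideVertex h)) :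
    L.pos k m (emb m c s w) = place c s (L.loc w) := by
  cases w
  · simp [emb, pos, place, L.loc_hub]
  · simp [emb, pos]

lemma segment_pos (e : Edg k h) :
    segment ℝ (L.pos k m (esrc m e)) (L.pos k m (edst m e)) =
      place e.1 e.2.1 '' e.2.2.seg L.loc := by
  rw [esrc, edst, pos_emb, pos_emb, segment_place, SideEdge.seg]

lemma bounds_of_mem_seg {e : SideEdge h} {p : ℝ × ℝ} (hp : p ∈ e.seg L.loc) :
    0 ≤ p.1 ∧ |p.2| < 5 ∧ (p.1 = 0 → p = L.loc none) := by
  obtain ⟨t, t0, t1, hx, hy⟩ := mem_segment_prod.1 hp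
  have hx' := L.x_pos e.tgt
  have hy' := abs_lt.1 (L.y_bound e.tgt)
  simp only [SideEdge.dst] at hx hy
  generalize e.src = w at hx hy
  have hw : |(L.loc w).2| < 5 := by
    cases w
    · simp [L.loc_hub]
    · exact L.y_bound _
  have hw0 : 0 ≤ (L.loc w).1 := by
    cases w
    · simp [L.loc_hub]
    · exact (L.x_pos _).le
  rw [abs_lt] at hw
  have hconv := convex_Ioo (-5 : ℝ) 5 hw hy' (sub_nonneg.2 t1) t0 (by ring)
  refine ⟨by rw [hx]; nlinarith, by rw [hy, abs_lt]; exact hconv, fun h0 => ?_⟩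
  have ht : t = 0 := by
    by_contra hne
    have : 0 < t := lt_of_le_of_ne t0 (Ne.symm hne)
    nlinarith
  subst ht
  cases w with
  | none => exact Prod.ext (by linarith) (by linarith)
  | some w => linarith [L.x_pos w]

lemma exists_loc_of_pos_mem {c : Fin k} {s : Bool} {e : SideEdge h} {v : Vtx k h m}
    (hv : L.pos k m v ∈ place c s '' e.seg L.loc) :
    ∃ w, v = emb m c s w ∧ L.loc w ∈ e.seg L.loc := by
  obtain ⟨p, hp, hpv⟩ := hv
  obtain ⟨p0, py, phub⟩ := L.bounds_of_mem_seg hp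
  rw [abs_lt] at py
  have key : ∀ n n' : ℕ, ∀ y : ℝ, |y| < 5 → p.2 + 10 * n = y + 10 * n' → n = n' := by
    intro n n' y hy e
    rw [abs_lt] at hy
    have h1 : (n : ℝ) < n' + 1 := by linarith
    have h2 : (n' : ℝ) < n + 1 := by linarith
    have h1' : n < n' + 1 := by exact_mod_cast h1
    have h2' : n' < n + 1 := by exact_mod_cast h2
    omega
  rcases v with r | ⟨c', _ | ⟨s', w⟩⟩
  · have := key c (k + r) 0 (by simp) (by simpa [pos, place] using congrArg Prod.snd hpv)
    omega
  · have hc := key c c' 0 (by simp) (by simpa [pos, place] using congrArg Prod.snd hpv)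
    obtain rfl := Fin.ext hc
    refine ⟨none, rfl, ?_⟩
    rw [← phub]
    · exact hp
    · cases s <;> simpa [pos, place] using congrArg Prod.fst hpv
  · have hc := key c c' _ (L.y_bound w) (by simpa [pos, place] using congrArg Prod.snd hpv)
    obtain rfl := Fin.ext hc
    have hs : s = s' := by
      have := congrArg Prod.fst hpv
      have := L.x_pos w
      cases s <;> cases s' <;> simp_all [pos, place] <;> linarith
    subst hs
    refine ⟨some w, rfl, ?_⟩
    rw [← place_injective c s hpv]
    exact hp

lemma pos_injective : Function.Injective (L.pos k m) := by
  have key : ∀ n n' : ℕ, ∀ y y' : ℝ, |y| < 5 → |y'| < 5 → y + 10 * n = y' + 10 * n' → n = n' := by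
    intro n n' y y' hy hy' e
    rw [abs_lt] at hy hy'
    have h1 : (n : ℝ) < n' + 1 := by linarith
    have h2 : (n' : ℝ) < n + 1 := by linarith
    have h1' : n < n' + 1 := by exact_mod_cast h1
    have h2' : n' < n + 1 := by exact_mod_cast h2
    omega
  have hub_inl : ∀ (v : Vtx k h m) (r : Fin m), L.pos k m v = L.pos k m (Sum.inl r) →
      v = Sum.inl r := by
    rintro (r' | ⟨c, _ | ⟨s, w⟩⟩) r e <;> replace e := congrArg Prod.snd e
    · have := key (k + r') (k + r) 0 0 (by simp) (by simp) (by simpa [pos, place] using e)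
      simp only [Sum.inl.injEq]
      omega
    · have := key c (k + r) 0 0 (by simp) (by simp) (by simpa [pos, place] using e)
      omega
    · have := key c (k + r) _ 0 (L.y_bound w) (by simp) (by simpa [pos, place] using e)
      omega
  intro u v e
  rcases u with r | ⟨c, _ | ⟨s, w⟩⟩
  · exact (hub_inl _ _ e.symm).symm
  all_goals rcases v with r' | ⟨c', _ | ⟨s', w'⟩⟩
  · exact hub_inl _ _ e
  · have := key c c' 0 0 (by simp) (by simp) (by simpa [pos, place] using congrArg Prod.snd e)
    rw [Fin.ext this]
  · have := L.x_pos w'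
    have := congrArg Prod.fst e
    cases s' <;> simp_all [pos, place]
  · exact hub_inl _ _ e
  · have := L.x_pos w
    have := congrArg Prod.fst e
    cases s <;> simp_all [pos, place]
  · have := key c c' _ _ (L.y_bound w) (L.y_bound w')
      (by simpa [pos, place] using congrArg Prod.snd e)
    obtain rfl := Fin.ext this
    have hs : s = s' := by
      have := L.x_pos w
      have := L.x_pos w'
      have := congrArg Prod.fst e
      cases s <;> cases s' <;> simp_all [pos, place] <;> linarith
    subst hs
    have := L.inj (place_injective c s e)
    rw [Option.some_injective _ this]

lemma meet {c c' : Fin k} {s s' : Bool} {e e' : SideEdge h} {p : ℝ × ℝ}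
    (hp : p ∈ place c s '' e.seg L.loc) (hp' : p ∈ place c' s' '' e'.seg L.loc) :
    (c = c' ∧ s = s') ∨ p = L.pos k m (emb m c s none) := by
  obtain ⟨q, hq, rfl⟩ := hp
  obtain ⟨q', hq', he⟩ := hp'
  obtain ⟨q0, qy, qhub⟩ := L.bounds_of_mem_seg hq
  obtain ⟨q0', qy', qhub'⟩ := L.bounds_of_mem_seg hq'
  have e1 := congrArg Prod.fst he
  have e2 := congrArg Prod.snd he
  simp only [place] at e1 e2
  rw [abs_lt] at qy qy'
  have h1 : (c : ℝ) < (c' : ℕ) + 1 := by linarith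
  have h2 : (c' : ℝ) < (c : ℕ) + 1 := by linarith
  have h1' : (c : ℕ) < c' + 1 := by exact_mod_cast h1
  have h2' : (c' : ℕ) < c + 1 := by exact_mod_cast h2
  have hc : c = c' := Fin.ext (by omega)
  by_cases hs : s = s'
  · exact Or.inl ⟨hc, hs⟩
  · right
    rw [pos_emb, ← qhub]
    cases s <;> cases s' <;> simp_all <;> linarith

lemma no_triple_pos (p : ℝ × ℝ) (hp : p ∉ range (L.pos k m)) (e f g : Edg k h)
    (hef : e ≠ f) (heg : e ≠ g) (hfg : f ≠ g)
    (pe : p ∈ place e.1 e.2.1 '' e.2.2.seg L.loc) (pf : p ∈ place f.1 f.2.1 '' f.2.2.seg L.loc) :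
    p ∉ place g.1 g.2.1 '' g.2.2.seg L.loc := by
  intro pg
  obtain ⟨c, s, e⟩ := e
  obtain ⟨c', s', f⟩ := f
  obtain ⟨c'', s'', g⟩ := g
  rcases L.meet (m := m) pe pf with ⟨rfl, rfl⟩ | h
  · rcases L.meet (m := m) pe pg with ⟨rfl, rfl⟩ | h
    · obtain ⟨q, qe, rfl⟩ := pe
      have inj := place_injective c s
      rw [inj.mem_set_image] at pf pg
      refine L.no_triple q ?_ e f g ?_ ?_ ?_ qe pf pg
      · rintro ⟨w, rfl⟩
        exact hp ⟨emb m c s w, L.pos_emb c s w⟩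
      · rintro rfl
        exact hef rfl
      · rintro rfl
        exact heg rfl
      · rintro rfl
        exact hfg rfl
    · exact hp ⟨_, h.symm⟩
  · exact hp ⟨_, h.symm⟩

/-- The drawing obtained by placing all half-strips. -/
def drawing (k m : ℕ) : Drawing (hubGraph k h m) :=
  straightDrawing (L.pos k m) L.pos_injective
    (by
      intro e v h1 h2
      rw [L.segment_pos]
      intro hv
      obtain ⟨w, rfl, hw⟩ := L.exists_loc_of_pos_mem hv
      refine L.avoids e.2.2 w ?_ ?_ hw
      · rintro rfl
        exact h1 rfl
      · rintro rfl
        exact h2 rfl)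
    (by
      intro e f hef
      rw [L.segment_pos, L.segment_pos]
      obtain ⟨c, s, e⟩ := e
      obtain ⟨c', s', f⟩ := f
      by_cases hcs : c = c' ∧ s = s'
      · obtain ⟨rfl, rfl⟩ := hcs
        rw [← image_inter (place_injective c s)]
        refine (L.finite e f ?_).image _
        rintro rfl
        exact hef rfl
      · refine (finite_singleton (L.pos k m (emb m c s none))).subset ?_
        rintro p ⟨pe, pf⟩
        exact (L.meet pe pf).resolve_left hcs)
    (by
      intro p hp e f g hef heg hfg
      rw [L.segment_pos, L.segment_pos, L.segment_pos]
      exact L.no_triple_pos p hp e f g hef heg hfg)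

lemma drawing_crossing {a b : Sym2 (Vtx k h m)} {p : ℝ × ℝ}
    (hc : (L.drawing k m).Crossing a b p) :
    ∃ c s e f q, a = s(esrc m (c, s, e), edst m (c, s, e)) ∧
      b = s(esrc m (c, s, f), edst m (c, s, f)) ∧ e ≠ f ∧ p = place c s q ∧
      q ∈ e.seg L.loc ∧ q ∈ f.seg L.loc ∧ q ∉ range L.loc := by
  obtain ⟨⟨c, s, e⟩, ⟨c', s', f⟩, rfl, rfl, hef, pe, pf, hp⟩ := straightDrawing_crossing hc
  rw [L.segment_pos] at pe pf
  rcases L.meet (m := m) pe pf with ⟨h1, h2⟩ | h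
  · simp only at h1 h2
    subst h1 h2
    obtain ⟨q, qe, rfl⟩ := pe
    rw [(place_injective c s).mem_set_image] at pf
    refine ⟨c, s, e, f, q, rfl, rfl, ?_, rfl, qe, pf, ?_⟩
    · rintro rfl
      exact hef rfl
    · rintro ⟨w, rfl⟩
      exact hp ⟨emb m c s w, L.pos_emb c s w⟩
  · exact (hp ⟨_, h.symm⟩).elim

lemma isKApex_drawing (hL : ∀ e f : SideEdge h, e ≠ f → ∀ q ∈ e.seg L.loc, q ∈ f.seg L.loc →
    q ∉ range L.loc → e.src = none ∨ f.src = none) : (L.drawing k m).IsKApex k := by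
  classical
  refine ⟨Finset.univ.image fun c => emb m c true none, Finset.card_image_le.trans (by simp), ?_⟩
  rintro p ⟨a, b, hc⟩
  obtain ⟨c, s, e, f, q, rfl, rfl, hef, rfl, qe, qf, hq⟩ := L.drawing_crossing hc
  have hmem : (emb m c true none : Vtx k h m) ∈ Finset.univ.image fun c => emb m c true none :=
    Finset.mem_image_of_mem _ (Finset.mem_univ c)
  rcases hL e f hef q qe qf hq with h0 | h0
  · refine ⟨_, _, hc, _, hmem, ?_⟩
    simp only [esrc, h0]
    exact Sym2.mem_mk_left _ _
  · obtain ⟨h1, h2, h3, h4, h5, h6⟩ := hc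
    refine ⟨_, _, ⟨h2, h1, h3.symm, h5, h4, h6⟩, _, hmem, ?_⟩
    simp only [esrc, h0]
    exact Sym2.mem_mk_left _ _

lemma crossings_drawing_le (q₀ : ℝ × ℝ) (hL : ∀ e f : SideEdge h, e ≠ f → ∀ q ∈ e.seg L.loc,
    q ∈ f.seg L.loc → q ∉ range L.loc → q = q₀) : (L.drawing k m).crossings ≤ 2 * k := by
  have hsub : (L.drawing k m).crossingSet ⊆
      range fun x : Fin k × Bool => place x.1 x.2 q₀ := by
    rintro p ⟨a, b, hc⟩
    obtain ⟨c, s, e, f, q, rfl, rfl, hef, rfl, qe, qf, hq⟩ := L.drawing_crossing hc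
    exact ⟨(c, s), by rw [hL e f hef q qe qf hq]⟩
  refine (ncard_le_ncard hsub (finite_range _)).trans ?_
  rw [← image_univ]
  refine (ncard_image_le (Set.toFinite _)).trans ?_
  simp [ncard_univ, mul_comm]

end Layout

end

namespace Drawing

variable {V : Type} {G : SimpleGraph V}

/-- The arc of an edge as a path. -/
def path (Γ : Drawing G) {u v : V} (huv : G.Adj u v) : Path (Γ.vpos u) (Γ.vpos v) where
  toFun t := Γ.arc u v t
  continuous_toFun := continuousOn_iff_continuous_domRestrict.1 (Γ.arc_cont u v huv)
  source' := Γ.arc_start u v huv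
  target' := Γ.arc_end u v huv

lemma mem_img_of_mem_range_path (Γ : Drawing G) {u v : V} (huv : G.Adj u v) {p : ℝ × ℝ}
    (hp : p ∈ range (Γ.path huv)) : p ∈ Γ.img s(u, v) := by
  obtain ⟨t, rfl⟩ := hp
  exact ⟨t, t.2, rfl⟩

lemma mem_of_vpos_mem_img (Γ : Drawing G) {e : Sym2 V} (he : e ∈ G.edgeSet) {w : V}
    (hw : Γ.vpos w ∈ Γ.img e) : w ∈ e := by
  induction e with | _ u v =>
  obtain ⟨t, ht, htw⟩ := hw
  rcases ht.1.eq_or_lt with rfl | h0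
  · rw [Γ.arc_start u v he] at htw
    rw [← Γ.vpos_inj htw]
    exact Sym2.mem_mk_left _ _
  · rcases ht.2.eq_or_lt with rfl | h1
    · rw [Γ.arc_end u v he] at htw
      rw [← Γ.vpos_inj htw]
      exact Sym2.mem_mk_right _ _
    · exact (Γ.arc_avoids u v he t ⟨h0, h1⟩ ⟨w, htw.symm⟩).elim

lemma crossing_of_disjoint (Γ : Drawing G) {e f : Sym2 V} (he : e ∈ G.edgeSet)
    (hf : f ∈ G.edgeSet) (hd : ∀ w ∈ e, w ∉ f) {p : ℝ × ℝ} (pe : p ∈ Γ.img e)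
    (pf : p ∈ Γ.img f) : Γ.Crossing e f p := by
  refine ⟨he, hf, ?_, pe, pf, ?_⟩
  · rintro rfl
    induction e with | _ u v => exact hd u (Sym2.mem_mk_left _ _) (Sym2.mem_mk_left _ _)
  · rintro ⟨w, rfl⟩
    exact hd w (Γ.mem_of_vpos_mem_img he pe) (Γ.mem_of_vpos_mem_img hf pf)

end Drawing

section

variable {k h m : ℕ}

/-- The edge with a given index, as an unordered pair of vertices. -/
def edge (m : ℕ) (x : Edg k h) : Sym2 (Vtx k h m) := s(esrc m x, edst m x)

lemma edge_mem (x : Edg k h) : edge m x ∈ (hubGraph k h m).edgeSet :=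
  edgeGraph_adj.2 ⟨⟨x, rfl⟩, (emb_injective x.1 x.2.1).ne (src_ne_dst x.2.2)⟩

lemma mem_edge {c : Fin k} {s : Bool} {e : SideEdge h} {v : Vtx k h m} :
    v ∈ edge m (c, s, e) ↔ v = emb m c s e.src ∨ v = emb m c s e.dst := Sym2.mem_iff

lemma edge_injective : Function.Injective (edge m : Edg k h → Sym2 (Vtx k h m)) := by
  rintro ⟨c, s, e⟩ ⟨c', s', e'⟩ hee
  rcases Sym2.eq_iff.1 hee with ⟨h1, h2⟩ | ⟨h1, h2⟩
  · obtain ⟨-, h3, -⟩ := emb_eq_emb h1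
    obtain ⟨h4, h5, h6⟩ := emb_eq_emb h2
    simp only [SideEdge.dst, reduceCtorEq, or_false] at h3 h4 h5 h6
    subst h4 h6
    cases e <;> cases e' <;> simp_all [SideEdge.src, SideEdge.tgt]
  · obtain ⟨-, h3, -⟩ := emb_eq_emb h1
    obtain ⟨-, h4, -⟩ := emb_eq_emb h2
    cases e <;> cases e' <;> simp_all [SideEdge.src, SideEdge.tgt, SideEdge.dst]

/-- Among the edges using only the `i`-th midpoints there are two independent edges that cross. -/
lemma exists_crossing (Γ : Drawing (hubGraph k h m)) (c : Fin k) (s : Bool) (i : Fin h) :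
    ∃ e b j p, Γ.Crossing (edge m (c, s, e)) (edge m (c, s, .polePort b j)) p ∧
      ∀ j' i', e = .hubMid j' i' → i' = i := by
  let A : Fin 3 → Option (SideVertex h) := ![hub, pole true, pole false]
  let F : Fin 3 → Fin 3 → SideEdge h → Prop := fun a j e =>
    (a = 0 ∧ (e = .hubMid j i ∨ e = .midPort j i)) ∨
      (a = 1 ∧ e = .polePort true j) ∨ (a = 2 ∧ e = .polePort false j)
  have adj : ∀ e : SideEdge h, (hubGraph k h m).Adj (emb m c s e.src) (emb m c s e.dst) :=
    fun e => edge_mem (m := m) (c, s, e)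
  have hP : ∀ a j, ∃ P : Path (Γ.vpos (emb m c s (A a))) (Γ.vpos (emb m c s (port j))),
      ∀ p ∈ range P, ∃ e, F a j e ∧ p ∈ Γ.img (edge m (c, s, e)) := by
    intro a j
    fin_cases a
    · refine ⟨(Γ.path (adj (.hubMid j i))).trans (Γ.path (adj (.midPort j i))), fun p hp => ?_⟩
      rcases (Path.trans_range (Γ.path (adj (.hubMid j i))) (Γ.path (adj (.midPort j i)))).subset hp
        with hp | hp
      · exact ⟨.hubMid j i, by simp [F], Γ.mem_img_of_mem_range_path _ hp⟩
      · exact ⟨.midPort j i, by simp [F], Γ.mem_img_of_mem_range_path _ hp⟩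
    · exact ⟨Γ.path (adj (.polePort true j)), fun p hp =>
        ⟨.polePort true j, by simp [F], Γ.mem_img_of_mem_range_path _ hp⟩⟩
    · exact ⟨Γ.path (adj (.polePort false j)), fun p hp =>
        ⟨.polePort false j, by simp [F], Γ.mem_img_of_mem_range_path _ hp⟩⟩
  choose P hP using hP
  let φ : ℝ × ℝ → ℂ := Complex.equivRealProdCLM.symm
  obtain ⟨a, a', j, j', x, y, ha, hj, hxy⟩ := exists_independent_edges_meet
    (fun a => φ (Γ.vpos (emb m c s (A a)))) (fun j => φ (Γ.vpos (emb m c s (port j))))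
    (fun a j x => φ ((P a j).extend x))
    (fun a j => Complex.equivRealProdCLM.symm.continuous.comp (P a j).continuous_extend)
    (fun a j => by simp) (fun a j => by simp)
  replace hxy := Complex.equivRealProdCLM.symm.injective hxy
  obtain ⟨e, he, pe⟩ := hP a j ((P a j).extend x)
    (by rw [← Path.extend_range]; exact mem_range_self x)
  obtain ⟨f, hf, pf⟩ := hP a' j' ((P a j).extend x)
    (by rw [hxy, ← Path.extend_range]; exact mem_range_self y)
  have hf' : ∃ b, f = .polePort b j' := by
    rcases hf with ⟨rfl, -⟩ | ⟨-, rfl⟩ | ⟨-, rfl⟩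
    · exact (Fin.not_lt_zero _ ha).elim
    · exact ⟨_, rfl⟩
    · exact ⟨_, rfl⟩
  obtain ⟨b, rfl⟩ := hf'
  refine ⟨e, b, j', _, Γ.crossing_of_disjoint (edge_mem _) (edge_mem _) ?_ pe pf, ?_⟩
  · intro w hw hw'
    rw [mem_edge] at hw hw'
    have h1 : e.src ≠ pole b ∧ e.src ≠ port j' ∧ e.dst ≠ pole b ∧ e.dst ≠ port j' := by
      rcases he with ⟨rfl, rfl | rfl⟩ | ⟨rfl, rfl⟩ | ⟨rfl, rfl⟩
      · simp [SideEdge.src, SideEdge.dst, SideEdge.tgt]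
      · simp [SideEdge.src, SideEdge.dst, SideEdge.tgt, hj]
      · rcases hf with ⟨rfl, -⟩ | ⟨rfl, hf⟩ | ⟨rfl, hf⟩ <;>
          simp_all [SideEdge.src, SideEdge.dst, SideEdge.tgt]
      · rcases hf with ⟨rfl, -⟩ | ⟨rfl, hf⟩ | ⟨rfl, hf⟩ <;>
          simp_all [SideEdge.src, SideEdge.dst, SideEdge.tgt]
    obtain ⟨h1, h2, h3, h4⟩ := h1
    rcases hw with rfl | rfl <;> rcases hw' with hw' | hw'
    · exact h1 (emb_injective c s hw')
    · exact h2 (emb_injective c s hw')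
    · exact h3 (emb_injective c s hw')
    · exact h4 (emb_injective c s hw')
  · rintro j₁ i₁ rfl
    rcases he with ⟨-, he | he⟩ | ⟨-, he⟩ | ⟨-, he⟩ <;> cases he
    rfl

/-- A `k`-apex drawing uses all hubs as apices, and every index `i` of a midpoint contributes a
crossing for each side of each component. -/
theorem le_crossings_of_isKApex (hh : 0 < h) (Γ : Drawing (hubGraph k h m)) (hΓ : Γ.IsKApex k) :
    k * (2 * h) ≤ Γ.crossings := by
  classical
  obtain ⟨S, hS, hapex⟩ := hΓ
  have apex : ∀ a b p, Γ.Crossing a b p → ∃ v ∈ S, v ∈ a ∨ v ∈ b := by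
    intro a b p hc
    obtain ⟨a', b', hc', v, hv, hva⟩ := hapex p ⟨a, b, hc⟩
    refine ⟨v, hv, ?_⟩
    rcases Sym2.eq_iff.1 (hc.edges_eq hc') with ⟨rfl, rfl⟩ | ⟨rfl, rfl⟩
    · exact Or.inl hva
    · exact Or.inr hva
  have meets : ∀ c s, ∃ w, emb m c s w ∈ S := by
    intro c s
    obtain ⟨e, b, j, p, hc, -⟩ := exists_crossing Γ c s ⟨0, hh⟩
    obtain ⟨v, hv, hve⟩ := apex _ _ _ hc
    rw [mem_edge, mem_edge] at hve
    rcases hve with (rfl | rfl) | (rfl | rfl) <;> exact ⟨_, hv⟩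
  let comp : Vtx k h m → Option (Fin k) := Sum.elim (fun _ => none) fun x => some x.1
  have comp_emb : ∀ c s w, comp (emb m c s w) = some c := fun _ _ _ => rfl
  have inj : Set.InjOn comp S := by
    rw [← Finset.card_image_iff]
    refine le_antisymm Finset.card_image_le (hS.trans ?_)
    have hsub : Finset.univ.image (some : Fin k → Option (Fin k)) ⊆ S.image comp := by
      intro x hx
      obtain ⟨c, -, rfl⟩ := Finset.mem_image.1 hx
      obtain ⟨w, hw⟩ := meets c true
      exact Finset.mem_image.2 ⟨_, hw, comp_emb c true w⟩
    simpa [Finset.card_image_of_injective _ (Option.some_injective _)] using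
      Finset.card_le_card hsub
  have hub_mem : ∀ c s w, emb m c s w ∈ S → w = none := by
    intro c s w hw
    obtain ⟨w', hw'⟩ := meets c !s
    obtain ⟨-, -, hs | hs⟩ := emb_eq_emb (inj hw hw' rfl)
    · cases s <;> simp at hs
    · exact hs
  have crossing : ∀ x : Fin k × Bool × Fin h, ∃ p j b j',
      Γ.Crossing (edge m (x.1, x.2.1, .hubMid j x.2.2)) (edge m (x.1, x.2.1, .polePort b j')) p := by
    rintro ⟨c, s, i⟩
    obtain ⟨e, b, j', p, hc, he⟩ := exists_crossing Γ c s i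
    obtain ⟨v, hv, hve⟩ := apex _ _ _ hc
    rw [mem_edge, mem_edge] at hve
    rcases hve with (rfl | rfl) | (rfl | rfl) <;> have h0 := hub_mem _ _ _ hv
    · cases e with
      | hubMid j i' =>
        obtain rfl := he j i' rfl
        exact ⟨p, j, b, j', hc⟩
      | midPort j i' => simp [SideEdge.src] at h0
      | polePort b j => simp [SideEdge.src] at h0
    · simp [SideEdge.dst] at h0
    · simp [SideEdge.src] at h0
    · simp [SideEdge.dst] at h0
  choose q j b j' hq using crossing
  have q_inj : Function.Injective q := by
    rintro ⟨c, s, i⟩ ⟨c', s', i'⟩ hqq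
    have h1 := hq (c, s, i)
    rw [hqq] at h1
    rcases Sym2.eq_iff.1 (h1.edges_eq (hq (c', s', i'))) with ⟨h2, -⟩ | ⟨h2, -⟩
    · have h3 := edge_injective h2
      simp only [Prod.mk.injEq, SideEdge.hubMid.injEq] at h3
      obtain ⟨rfl, rfl, -, rfl⟩ := h3
      rfl
    · have h3 := edge_injective h2
      simp at h3
  have hsub : range q ⊆ Γ.crossingSet := by
    rintro _ ⟨x, rfl⟩
    exact ⟨_, _, hq x⟩
  have hcard : (range q).ncard = k * (2 * h) := by
    rw [← image_univ, ncard_image_of_injective _ q_inj, ncard_univ]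
    simp
  rw [← hcard]
  exact ncard_le_ncard hsub Γ.crossingSet_finite

end

section Layouts

variable {h : ℕ}

lemma fin_three_cases (j : Fin 3) : (j : ℝ) = 0 ∨ (j : ℝ) = 1 ∨ (j : ℝ) = 2 := by
  fin_cases j <;> simp

lemma fin_three_ext {j j' : Fin 3} (h₁ : (j : ℝ) < j' + 1) (h₂ : (j' : ℝ) < j + 1) : j = j' := by
  have h₁' : (j : ℕ) < j' + 1 := by exact_mod_cast h₁
  have h₂' : (j' : ℕ) < j + 1 := by exact_mod_cast h₂
  exact Fin.ext (by omega)

/-- Distinct numbers in the open unit interval. -/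
def frac (i : Fin h) : ℝ := ((i : ℕ) + 1) / (h + 1)

lemma frac_pos (i : Fin h) : 0 < frac i := by
  unfold frac; positivity

lemma frac_lt_one (i : Fin h) : frac i < 1 := by
  have : ((i : ℕ) : ℝ) < h := by exact_mod_cast i.2
  rw [frac, div_lt_one (by positivity)]
  linarith

lemma frac_injective : Function.Injective (frac : Fin h → ℝ) := by
  intro i i' hi
  have : (h : ℝ) + 1 ≠ 0 := by positivity
  rw [frac, frac, div_left_inj' this, add_left_inj] at hi
  exact Fin.ext (by exact_mod_cast hi)

/-! ### A drawing with a single crossing -/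

/-- The positions of the vertices in a drawing with a single crossing. -/
def oneLoc : Option (SideVertex h) → ℝ × ℝ
  | none => 0
  | some (Sum.inl (j, i)) => (1, 2 * j + frac i)
  | some (Sum.inr (Sum.inl j)) => (2, 2 * j)
  | some (Sum.inr (Sum.inr true)) => (3, 3)
  | some (Sum.inr (Sum.inr false)) => (5, 2)

/-- The points on a segment of the drawing with a single crossing. -/
def oneCond (q : ℝ × ℝ) : SideEdge h → Prop
  | .hubMid j i => 0 ≤ q.1 ∧ q.1 ≤ 1 ∧ q.2 = q.1 * (2 * j + frac i)
  | .midPort j i => 1 ≤ q.1 ∧ q.1 ≤ 2 ∧ q.2 = 2 * j + (2 - q.1) * frac i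
  | .polePort true j => 2 ≤ q.1 ∧ q.1 ≤ 3 ∧ q.2 = 3 - (3 - q.1) * (3 - 2 * j)
  | .polePort false j => 2 ≤ q.1 ∧ q.1 ≤ 5 ∧ 3 * q.2 = 6 - (5 - q.1) * (2 - 2 * j)

lemma oneCond_of_mem {q : ℝ × ℝ} {e : SideEdge h} (hq : q ∈ e.seg oneLoc) : oneCond q e := by
  obtain ⟨t, t0, t1, hx, hy⟩ := mem_segment_prod.1 hq
  rcases e with ⟨j, i⟩ | ⟨j, i⟩ | ⟨_ | _, j⟩ <;>
    simp only [SideEdge.src, SideEdge.dst, SideEdge.tgt, oneLoc, Prod.fst_zero,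
      Prod.snd_zero] at hx hy <;>
    refine ⟨by linarith, by linarith, ?_⟩ <;> rw [hx, hy] <;> ring

lemma oneLoc_injective : Function.Injective (oneLoc : Option (SideVertex h) → ℝ × ℝ) := by
  intro w w' hw
  rcases w with _ | ⟨j, i⟩ | j | _ | _ <;> rcases w' with _ | ⟨j', i'⟩ | j' | _ | _ <;>
    simp only [oneLoc, Prod.ext_iff, Prod.fst_zero, Prod.snd_zero] at hw <;>
    first
    | rfl
    | (exfalso; linarith [hw.1])
    | skip
  · have := frac_pos i; have := frac_pos i'
    have := frac_lt_one i; have := frac_lt_one i'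
    obtain rfl := fin_three_ext (j := j) (j' := j') (by linarith) (by linarith)
    obtain rfl := frac_injective (show frac i = frac i' by linarith)
    rfl
  · obtain rfl := fin_three_ext (j := j) (j' := j') (by linarith) (by linarith)
    rfl

lemma oneLoc_avoids (e : SideEdge h) (w : Option (SideVertex h)) (h₁ : w ≠ e.src)
    (h₂ : w ≠ e.dst) : oneLoc w ∉ e.seg oneLoc := by
  intro hw
  have hc := oneCond_of_mem hw
  rcases e with ⟨j, i⟩ | ⟨j, i⟩ | ⟨_ | _, j⟩ <;> rcases w with _ | ⟨j', i'⟩ | j' | _ | _ <;>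
    simp only [oneCond, oneLoc, Prod.fst_zero, Prod.snd_zero] at hc <;>
    obtain ⟨c₁, c₂, c₃⟩ := hc <;>
    first
    | linarith
    | exact h₁ rfl
    | exact h₂ (oneLoc_injective (Prod.ext (by simp [oneLoc, SideEdge.dst, SideEdge.tgt])
        (by simp only [oneLoc, SideEdge.dst, SideEdge.tgt]; linarith)))
    | exact h₁ (oneLoc_injective (Prod.ext (by simp [oneLoc, SideEdge.src])
        (by simp only [oneLoc, SideEdge.src]; linarith)))
    | (rcases fin_three_cases j with hj | hj | hj <;> rw [hj] at c₃ <;> linarith)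

lemma oneLoc_inter {e f : SideEdge h} (hef : e ≠ f) {q : ℝ × ℝ} (he : q ∈ e.seg oneLoc)
    (hf : q ∈ f.seg oneLoc) (hq : q ∉ range (oneLoc : Option (SideVertex h) → ℝ × ℝ)) :
    q = (8 / 3, 2) ∧ (e = .polePort true 0 ∧ f = .polePort false 1 ∨
      e = .polePort false 1 ∧ f = .polePort true 0) := by
  have hq' : ∀ w : Option (SideVertex h), q.1 = (oneLoc w).1 → q.2 = (oneLoc w).2 → False :=
    fun w h₁ h₂ => hq ⟨w, (Prod.ext h₁ h₂).symm⟩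
  replace he := oneCond_of_mem he
  replace hf := oneCond_of_mem hf
  have hubs : ∀ j i j' i', (SideEdge.hubMid j i : SideEdge h) ≠ .hubMid j' i' →
      oneCond q (.hubMid j i) → oneCond q (.hubMid j' i') → False := by
    rintro j i j' i' hne ⟨a₁, a₂, a₃⟩ ⟨b₁, b₂, b₃⟩
    have : q.1 * ((2 * j + frac i) - (2 * j' + frac i')) = 0 := by linarith
    rcases mul_eq_zero.1 this with h0 | h0
    · exact hq' hub h0 (by rw [a₃, h0]; simp [oneLoc])
    · have := oneLoc_injective (show oneLoc (mid j i) = oneLoc (mid j' i') from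
        Prod.ext rfl (by simp only [oneLoc]; linarith))
      simp_all
  have mids : ∀ j i j' i', (SideEdge.midPort j i : SideEdge h) ≠ .midPort j' i' →
      oneCond q (.midPort j i) → oneCond q (.midPort j' i') → False := by
    rintro j i j' i' hne ⟨a₁, a₂, a₃⟩ ⟨b₁, b₂, b₃⟩
    have := frac_pos i; have := frac_pos i'
    have := frac_lt_one i; have := frac_lt_one i'
    obtain rfl := fin_three_ext (j := j) (j' := j') (by nlinarith) (by nlinarith)
    have : (2 - q.1) * (frac i - frac i') = 0 := by linarith
    rcases mul_eq_zero.1 this with h0 | h0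
    · exact hq' (port j) (by simp only [oneLoc]; linarith)
        (by rw [a₃, h0]; simp [oneLoc])
    · exact hne (by rw [frac_injective (sub_eq_zero.1 h0)])
  have hubmid : ∀ j i j' i', oneCond q (.hubMid j i : SideEdge h) →
      oneCond q (.midPort j' i' : SideEdge h) → False := by
    rintro j i j' i' ⟨a₁, a₂, a₃⟩ ⟨b₁, b₂, b₃⟩
    have h1 : q.1 = 1 := by linarith
    exact hq' (mid j i) h1 (by rw [a₃, h1]; simp [oneLoc])
  have hubpole : ∀ j i b j', oneCond q (.hubMid j i : SideEdge h) →
      oneCond q (.polePort b j' : SideEdge h) → False := by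
    rintro j i (_ | _) j' ⟨a₁, a₂, a₃⟩ ⟨b₁, b₂, b₃⟩ <;> linarith
  have midpole : ∀ j i b j', oneCond q (.midPort j i : SideEdge h) →
      oneCond q (.polePort b j' : SideEdge h) → False := by
    rintro j i (_ | _) j' ⟨a₁, a₂, a₃⟩ ⟨b₁, b₂, b₃⟩ <;>
    · have h1 : q.1 = 2 := by linarith
      exact hq' (port j) h1 (by rw [a₃, h1]; simp [oneLoc])
  have poles : ∀ b j j', (SideEdge.polePort b j : SideEdge h) ≠ .polePort b j' →
      oneCond q (.polePort b j : SideEdge h) → oneCond q (.polePort b j' : SideEdge h) → False := by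
    rintro (_ | _) j j' hne ⟨a₁, a₂, a₃⟩ ⟨b₁, b₂, b₃⟩
    · have : (5 - q.1) * ((j : ℝ) - j') = 0 := by linarith
      rcases mul_eq_zero.1 this with h0 | h0
      · exact hq' (pole false) (by simp only [oneLoc]; linarith)
          (by rw [h0] at a₃; simp only [oneLoc]; linarith)
      · exact hne (by rw [fin_three_ext (j := j) (j' := j') (by linarith) (by linarith)])
    · have : (3 - q.1) * ((j : ℝ) - j') = 0 := by linarith
      rcases mul_eq_zero.1 this with h0 | h0
      · exact hq' (pole true) (by simp only [oneLoc]; linarith)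
          (by rw [h0] at a₃; simp only [oneLoc]; linarith)
      · exact hne (by rw [fin_three_ext (j := j) (j' := j') (by linarith) (by linarith)])
  have cross : ∀ j j', oneCond q (.polePort true j : SideEdge h) →
      oneCond q (.polePort false j' : SideEdge h) → q = (8 / 3, 2) ∧ j = 0 ∧ j' = 1 := by
    rintro j j' ⟨a₁, a₂, a₃⟩ ⟨b₁, b₂, b₃⟩
    have hX : q.1 ≠ 2 := fun h1 => hq' (port j) h1
      (by rw [a₃, h1]; simp only [oneLoc]; ring)
    have hX' : 2 < q.1 := lt_of_le_of_ne a₁ hX.symm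
    rcases fin_three_cases j with hj | hj | hj <;>
      rcases fin_three_cases j' with hj' | hj' | hj' <;> rw [hj] at a₃ <;> rw [hj'] at b₃ <;>
      first
      | (exfalso; linarith)
      | exact ⟨Prod.ext (by simp only; linarith) (by simp only; linarith),
          fin_three_ext (by simp [hj]) (by simp [hj]), fin_three_ext (by simp [hj']) (by simp [hj'])⟩
  rcases e with ⟨j, i⟩ | ⟨j, i⟩ | ⟨b, j⟩ <;> rcases f with ⟨j', i'⟩ | ⟨j', i'⟩ | ⟨b', j'⟩
  · exact (hubs _ _ _ _ hef he hf).elim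
  · exact (hubmid _ _ _ _ he hf).elim
  · exact (hubpole _ _ _ _ he hf).elim
  · exact (hubmid _ _ _ _ hf he).elim
  · exact (mids _ _ _ _ hef he hf).elim
  · exact (midpole _ _ _ _ he hf).elim
  · exact (hubpole _ _ _ _ hf he).elim
  · exact (midpole _ _ _ _ hf he).elim
  · by_cases hb : b = b'
    · subst hb
      exact (poles _ _ _ hef he hf).elim
    · cases b <;> cases b' <;> try exact (hb rfl).elim
      · obtain ⟨h₁, rfl, rfl⟩ := cross _ _ hf he
        exact ⟨h₁, Or.inr ⟨rfl, rfl⟩⟩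
      · obtain ⟨h₁, rfl, rfl⟩ := cross _ _ he hf
        exact ⟨h₁, Or.inl ⟨rfl, rfl⟩⟩

/-- A drawing of a thickened `K₃,₃` with a single crossing. -/
def oneLayout (h : ℕ) : Layout h where
  loc := oneLoc
  loc_hub := rfl
  x_pos := by rintro (⟨j, i⟩ | j | _ | _) <;> simp [oneLoc]
  y_bound := by
    rintro (⟨j, i⟩ | j | _ | _) <;> simp only [oneLoc, abs_lt] <;>
      first
      | (have := frac_pos i; have := frac_lt_one i
         rcases fin_three_cases j with hj | hj | hj <;> rw [hj] <;> constructor <;> linarith)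
      | (rcases fin_three_cases j with hj | hj | hj <;> rw [hj] <;> constructor <;> linarith)
      | norm_num
  inj := oneLoc_injective
  avoids := oneLoc_avoids
  finite := fun e f hef => ((finite_range (oneLoc (h := h))).insert (8 / 3, 2)).subset
    fun q hq => or_iff_not_imp_right.2 fun hq' => (oneLoc_inter hef hq.1 hq.2 hq').1
  no_triple := by
    intro p hp e f g hef heg hfg he hf hg
    rcases (oneLoc_inter hef he hf hp).2 with ⟨rfl, rfl⟩ | ⟨rfl, rfl⟩ <;>
      rcases (oneLoc_inter heg he hg hp).2 with ⟨h₁, rfl⟩ | ⟨h₁, rfl⟩ <;> simp_all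

/-! ### A drawing in which every crossing involves an edge at the hub -/

/-- The positions of the vertices in a drawing in which every crossing involves an edge at the
hub. -/
def apexLoc : Option (SideVertex h) → ℝ × ℝ
  | none => 0
  | some (Sum.inl (j, i)) => (j + 5 / 4, (j + 5 / 4) * ((j + frac i) / 48))
  | some (Sum.inr (Sum.inl j)) => (j + 1, 0)
  | some (Sum.inr (Sum.inr true)) => (2, 4)
  | some (Sum.inr (Sum.inr false)) => (2, -4)

/-- The points on a segment of the drawing in which every crossing involves an edge at the hub. -/
def apexCond (q : ℝ × ℝ) : SideEdge h → Prop
  | .hubMid j i => 0 ≤ q.1 ∧ q.1 ≤ j + 5 / 4 ∧ q.2 = q.1 * ((j + frac i) / 48)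
  | .midPort j i => j + 1 ≤ q.1 ∧ q.1 ≤ j + 5 / 4 ∧
      q.2 = 4 * (q.1 - j - 1) * ((j + 5 / 4) * ((j + frac i) / 48))
  | .polePort true j => 0 ≤ q.2 ∧ q.2 ≤ 4 ∧ q.1 = 2 + (1 - q.2 / 4) * (j - 1)
  | .polePort false j => -4 ≤ q.2 ∧ q.2 ≤ 0 ∧ q.1 = 2 + (1 + q.2 / 4) * (j - 1)

lemma apexCond_of_mem {q : ℝ × ℝ} {e : SideEdge h} (hq : q ∈ e.seg apexLoc) : apexCond q e := by
  obtain ⟨t, t0, t1, hx, hy⟩ := mem_segment_prod.1 hq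
  rcases e with ⟨j, i⟩ | ⟨j, i⟩ | ⟨_ | _, j⟩ <;>
    simp only [SideEdge.src, SideEdge.dst, SideEdge.tgt, apexLoc, Prod.fst_zero,
      Prod.snd_zero] at hx hy
  · have : (0 : ℝ) ≤ j := by positivity
    exact ⟨by rw [hx]; nlinarith, by rw [hx]; nlinarith, by rw [hx, hy]; ring⟩
  · exact ⟨by linarith, by linarith, by rw [hx, hy]; ring⟩
  · exact ⟨by linarith, by linarith, by rw [hx, hy]; ring⟩
  · exact ⟨by linarith, by linarith, by rw [hx, hy]; ring⟩

/-- The slopes of the edges at the hub are small. -/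
lemma slope_bounds (j : Fin 3) (i : Fin h) :
    0 < ((j : ℝ) + frac i) / 48 ∧ ((j : ℝ) + frac i) / 48 < 1 / 16 := by
  have := frac_pos i; have := frac_lt_one i
  rcases fin_three_cases j with hj | hj | hj <;> rw [hj] <;> constructor <;> linarith

lemma slope_injective {j j' : Fin 3} {i i' : Fin h}
    (hs : ((j : ℝ) + frac i) / 48 = ((j' : ℝ) + frac i') / 48) : j = j' ∧ i = i' := by
  have := frac_pos i; have := frac_pos i'
  have := frac_lt_one i; have := frac_lt_one i'
  obtain rfl := fin_three_ext (j := j) (j' := j') (by linarith) (by linarith)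
  exact ⟨rfl, frac_injective (by linarith)⟩

lemma height_bounds (j : Fin 3) (i : Fin h) :
    0 < ((j : ℝ) + 5 / 4) * ((j + frac i) / 48) ∧
      ((j : ℝ) + 5 / 4) * ((j + frac i) / 48) < 1 / 4 := by
  obtain ⟨h₁, h₂⟩ := slope_bounds j i
  generalize ((j : ℝ) + frac i) / 48 = r at h₁ h₂
  rcases fin_three_cases j with hj | hj | hj <;> rw [hj] <;> constructor <;> linarith

lemma apexLoc_injective : Function.Injective (apexLoc : Option (SideVertex h) → ℝ × ℝ) := by
  intro w w' hw
  rcases w with _ | ⟨j, i⟩ | j | _ | _ <;> rcases w' with _ | ⟨j', i'⟩ | j' | _ | _ <;>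
    simp only [apexLoc, Prod.ext_iff, Prod.fst_zero, Prod.snd_zero] at hw <;>
    obtain ⟨hx, hy⟩ := hw <;>
    first
    | rfl
    | (exfalso; linarith)
    | (exfalso; linarith [height_bounds j i])
    | (exfalso; linarith [height_bounds j' i'])
    | skip
  · obtain rfl := fin_three_ext (j := j) (j' := j') (by linarith) (by linarith)
    obtain ⟨-, rfl⟩ := slope_injective (mul_left_cancel₀ (by positivity) hy)
    rfl
  · obtain rfl := fin_three_ext (j := j) (j' := j') (by linarith) (by linarith)
    rfl

lemma apexLoc_avoids (e : SideEdge h) (w : Option (SideVertex h)) (h₁ : w ≠ e.src)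
    (h₂ : w ≠ e.dst) : apexLoc w ∉ e.seg apexLoc := by
  intro hw
  have hc := apexCond_of_mem hw
  rcases e with ⟨j, i⟩ | ⟨j, i⟩ | ⟨b, j⟩
  · have hm := slope_bounds j i
    have hj : (j : ℝ) ≤ 2 := by rcases fin_three_cases j with hj | hj | hj <;> linarith
    rcases w with _ | ⟨j', i'⟩ | j' | _ | _ <;> simp only [apexCond, apexLoc] at hc <;>
      obtain ⟨c₁, c₂, c₃⟩ := hc
    · exact h₁ rfl
    · have h0 := mul_left_cancel₀ (by positivity) c₃
      obtain ⟨rfl, rfl⟩ := slope_injective h0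
      exact h₂ rfl
    · have : 0 < ((j' : ℝ) + 1) * (((j : ℝ) + frac i) / 48) := mul_pos (by positivity) hm.1
      linarith
    · linarith
    · linarith
  · have hm := height_bounds j i
    rcases w with _ | ⟨j', i'⟩ | j' | _ | _ <;>
      simp only [apexCond, apexLoc, Prod.fst_zero, Prod.snd_zero] at hc <;>
      obtain ⟨c₁, c₂, c₃⟩ := hc
    · have : (0 : ℝ) ≤ j := by positivity
      linarith
    · obtain rfl := fin_three_ext (j := j) (j' := j') (by linarith) (by linarith)
      have h0 : ((j : ℝ) + 5 / 4) * ((j + frac i') / 48) =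
        (j + 5 / 4) * ((j + frac i) / 48) := by linarith
      obtain ⟨-, rfl⟩ := slope_injective (mul_left_cancel₀ (by positivity) h0)
      exact h₁ rfl
    · rcases mul_eq_zero.1 c₃.symm with h0 | h0
      · exact h₂ (by rw [fin_three_ext (j := j) (j' := j') (by linarith) (by linarith)]; rfl)
      · linarith
    · nlinarith
    · nlinarith
  · have hpole : ∀ b' : Bool, pole b' ≠ (SideEdge.polePort b j : SideEdge h).src → b' = !b := by
      rintro b' hb
      cases b <;> cases b' <;> simp_all [SideEdge.src]
    rcases w with _ | ⟨j', i'⟩ | j' | b'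
    · cases b <;> simp only [apexCond, apexLoc, Prod.fst_zero, Prod.snd_zero] at hc <;>
        obtain ⟨c₁, c₂, c₃⟩ := hc <;>
        rcases fin_three_cases j with hj | hj | hj <;> rw [hj] at c₃ <;> linarith
    · have hm := height_bounds j' i'
      generalize hY : ((j' : ℝ) + 5 / 4) * ((j' + frac i') / 48) = Y at hm
      cases b <;> simp only [apexCond, apexLoc, hY] at hc <;> obtain ⟨c₁, c₂, c₃⟩ := hc
      · linarith
      · rcases fin_three_cases j with hj | hj | hj <;>
          rcases fin_three_cases j' with hj' | hj' | hj' <;> rw [hj, hj'] at c₃ <;> linarith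
    · cases b <;> simp only [apexCond, apexLoc] at hc <;> obtain ⟨c₁, c₂, c₃⟩ := hc <;>
        exact h₂ (by rw [fin_three_ext (j := j) (j' := j') (by linarith) (by linarith)]; rfl)
    · obtain rfl := hpole b' h₁
      cases b <;> simp only [apexCond, apexLoc, Bool.not_true, Bool.not_false] at hc <;> linarith

lemma apexLoc_hub_inter {j j' : Fin 3} {i i' : Fin h}
    (hne : SideEdge.hubMid j i ≠ .hubMid j' i') {q : ℝ × ℝ}
    (he : q ∈ (SideEdge.hubMid j i).seg apexLoc) (hf : q ∈ (SideEdge.hubMid j' i').seg apexLoc) :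
    q ∈ range (apexLoc : Option (SideVertex h) → ℝ × ℝ) := by
  obtain ⟨a₁, a₂, a₃⟩ := apexCond_of_mem he
  obtain ⟨b₁, b₂, b₃⟩ := apexCond_of_mem hf
  rcases mul_eq_mul_left_iff.1 (a₃.symm.trans b₃) with h0 | h0
  · obtain ⟨rfl, rfl⟩ := slope_injective h0
    exact (hne rfl).elim
  · exact ⟨hub, Prod.ext h0.symm (by rw [a₃, h0]; simp [apexLoc])⟩

lemma apexLoc_inter {e f : SideEdge h} (hef : e ≠ f) (he' : e.src ≠ none) (hf' : f.src ≠ none)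
    {q : ℝ × ℝ} (he : q ∈ e.seg apexLoc) (hf : q ∈ f.seg apexLoc) :
    q ∈ range (apexLoc : Option (SideVertex h) → ℝ × ℝ) := by
  have hw : ∀ w : Option (SideVertex h), q.1 = (apexLoc w).1 → q.2 = (apexLoc w).2 →
      q ∈ range (apexLoc : Option (SideVertex h) → ℝ × ℝ) :=
    fun w h₁ h₂ => ⟨w, (Prod.ext h₁ h₂).symm⟩
  replace he := apexCond_of_mem he
  replace hf := apexCond_of_mem hf
  have midpole : ∀ j i b j', apexCond q (.midPort j i : SideEdge h) →
      apexCond q (.polePort b j' : SideEdge h) →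
      q ∈ range (apexLoc : Option (SideVertex h) → ℝ × ℝ) := by
    rintro j i b j' ⟨a₁, a₂, a₃⟩ hb
    have hm := height_bounds j i
    generalize ((j : ℝ) + 5 / 4) * ((j + frac i) / 48) = Y at a₃ hm
    have y0 : 0 ≤ q.2 := by rw [a₃]; exact mul_nonneg (by linarith) hm.1.le
    have y1 : q.2 ≤ q.1 - j - 1 := by rw [a₃]; nlinarith
    suffices q.1 = j + 1 from hw (port j) this (by rw [a₃, this]; simp [apexLoc])
    cases b <;> obtain ⟨b₁, b₂, b₃⟩ := hb
    · have : q.2 = 0 := by linarith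
      rw [this] at b₃
      rw [fin_three_ext (j := j) (j' := j') (by linarith) (by linarith)]
      linarith
    · rcases fin_three_cases j with hj | hj | hj <;>
        rcases fin_three_cases j' with hj' | hj' | hj' <;> rw [hj'] at b₃ <;>
        linarith
  have poles : ∀ j j', apexCond q (.polePort true j : SideEdge h) →
      apexCond q (.polePort false j' : SideEdge h) →
      q ∈ range (apexLoc : Option (SideVertex h) → ℝ × ℝ) := by
    rintro j j' ⟨a₁, a₂, a₃⟩ ⟨b₁, b₂, b₃⟩
    have h0 : q.2 = 0 := by linarith
    exact hw (port j) (by rw [a₃, h0]; simp only [apexLoc]; ring) h0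
  rcases e with ⟨j, i⟩ | ⟨j, i⟩ | ⟨b, j⟩
  · exact (he' rfl).elim
  all_goals rcases f with ⟨j', i'⟩ | ⟨j', i'⟩ | ⟨b', j'⟩
  · exact (hf' rfl).elim
  · obtain ⟨a₁, a₂, a₃⟩ := he
    obtain ⟨b₁, b₂, b₃⟩ := hf
    obtain rfl := fin_three_ext (j := j) (j' := j') (by linarith) (by linarith)
    rcases mul_eq_mul_left_iff.1 (a₃.symm.trans b₃) with h0 | h0
    · obtain ⟨-, rfl⟩ := slope_injective (mul_left_cancel₀ (by positivity) h0)
      exact (hef rfl).elim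
    · exact hw (port j) (by simp only [apexLoc]; linarith) (by rw [a₃, h0]; simp [apexLoc])
  · exact midpole _ _ _ _ he hf
  · exact (hf' rfl).elim
  · exact midpole _ _ _ _ hf he
  · cases b <;> cases b'
    · obtain ⟨a₁, a₂, a₃⟩ := he
      obtain ⟨b₁, b₂, b₃⟩ := hf
      have : (1 + q.2 / 4) * ((j : ℝ) - j') = 0 := by linarith
      rcases mul_eq_zero.1 this with h0 | h0
      · exact hw (pole false) (by rw [a₃, h0]; simp [apexLoc]) (by simp only [apexLoc]; linarith)
      · exact (hef (by rw [fin_three_ext (j := j) (j' := j') (by linarith) (by linarith)])).elim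
    · exact poles _ _ hf he
    · exact poles _ _ he hf
    · obtain ⟨a₁, a₂, a₃⟩ := he
      obtain ⟨b₁, b₂, b₃⟩ := hf
      have : (1 - q.2 / 4) * ((j : ℝ) - j') = 0 := by linarith
      rcases mul_eq_zero.1 this with h0 | h0
      · exact hw (pole true) (by rw [a₃, h0]; simp [apexLoc]) (by simp only [apexLoc]; linarith)
      · exact (hef (by rw [fin_three_ext (j := j) (j' := j') (by linarith) (by linarith)])).elim

lemma apexLoc_subsingleton (j : Fin 3) (i : Fin h) {f : SideEdge h} (hf' : f.src ≠ none) :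
    ((SideEdge.hubMid j i).seg apexLoc ∩ f.seg apexLoc).Subsingleton := by
  rintro p ⟨hp, hp'⟩ q ⟨hq, hq'⟩
  obtain ⟨-, -, p₁⟩ := apexCond_of_mem hp
  obtain ⟨-, -, q₁⟩ := apexCond_of_mem hq
  replace hp' := apexCond_of_mem hp'
  replace hq' := apexCond_of_mem hq'
  have hm := slope_bounds j i
  generalize ((j : ℝ) + frac i) / 48 = r at p₁ q₁ hm
  suffices p.1 = q.1 from Prod.ext this (by rw [p₁, q₁, this])
  rcases f with ⟨j', i'⟩ | ⟨j', i'⟩ | ⟨_ | _, j'⟩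
  · exact (hf' rfl).elim
  · obtain ⟨-, -, p₂⟩ := hp'
    obtain ⟨-, -, q₂⟩ := hq'
    have hY := height_bounds j' i'
    generalize ((j' : ℝ) + 5 / 4) * ((j' + frac i') / 48) = Y at p₂ q₂ hY
    rw [p₁] at p₂
    rw [q₁] at q₂
    have : (p.1 - q.1) * (r - 4 * Y) = 0 := by linarith
    rcases mul_eq_zero.1 this with h0 | h0
    · linarith
    · obtain rfl : r = 4 * Y := by linarith
      have : 0 < ((j' : ℝ) + 1) * Y := mul_pos (by positivity) hY.1
      linarith
  all_goals
    obtain ⟨-, -, p₂⟩ := hp'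
    obtain ⟨-, -, q₂⟩ := hq'
    rw [p₁] at p₂
    rw [q₁] at q₂
  · have : (p.1 - q.1) * (1 - r * (j' - 1) / 4) = 0 := by linarith
    rcases mul_eq_zero.1 this with h0 | h0
    · linarith
    · rcases fin_three_cases j' with hj | hj | hj <;> rw [hj] at h0 <;> linarith
  · have : (p.1 - q.1) * (1 + r * (j' - 1) / 4) = 0 := by linarith
    rcases mul_eq_zero.1 this with h0 | h0
    · linarith
    · rcases fin_three_cases j' with hj | hj | hj <;> rw [hj] at h0 <;> linarith

lemma exists_eq_hubMid {e : SideEdge h} (he : e.src = none) : ∃ j i, e = .hubMid j i := by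
  cases e <;> simp_all [SideEdge.src]

/-- A crossing in the drawing involves exactly one edge at the hub. -/
lemma apexLoc_src {e f : SideEdge h} (hef : e ≠ f) {q : ℝ × ℝ} (he : q ∈ e.seg apexLoc)
    (hf : q ∈ f.seg apexLoc) (hq : q ∉ range (apexLoc : Option (SideVertex h) → ℝ × ℝ)) :
    e.src = none ↔ f.src ≠ none := by
  constructor
  · intro h₁ h₂
    obtain ⟨j, i, rfl⟩ := exists_eq_hubMid h₁
    obtain ⟨j', i', rfl⟩ := exists_eq_hubMid h₂
    exact hq (apexLoc_hub_inter hef he hf)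
  · intro h₁
    by_contra h₂
    exact hq (apexLoc_inter hef h₂ h₁ he hf)

/-- A drawing of a thickened `K₃,₃` in which every crossing involves an edge at the hub. -/
def apexLayout (h : ℕ) : Layout h where
  loc := apexLoc
  loc_hub := rfl
  x_pos := by rintro (⟨j, i⟩ | j | _ | _) <;> simp only [apexLoc] <;> positivity
  y_bound := by
    rintro (⟨j, i⟩ | j | _ | _) <;> simp only [apexLoc, abs_lt]
    · have := height_bounds j i
      constructor <;> linarith
    all_goals norm_num
  inj := apexLoc_injective
  avoids := apexLoc_avoids
  finite := by
    intro e f hef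
    by_cases he : e.src = none <;> by_cases hf : f.src = none
    · obtain ⟨j, i, rfl⟩ := exists_eq_hubMid he
      obtain ⟨j', i', rfl⟩ := exists_eq_hubMid hf
      exact (finite_range _).subset fun q hq => apexLoc_hub_inter hef hq.1 hq.2
    · obtain ⟨j, i, rfl⟩ := exists_eq_hubMid he
      exact (apexLoc_subsingleton j i hf).finite
    · obtain ⟨j, i, rfl⟩ := exists_eq_hubMid hf
      rw [inter_comm]
      exact (apexLoc_subsingleton j i he).finite
    · exact (finite_range _).subset fun q hq => apexLoc_inter hef he hf hq.1 hq.2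
  no_triple := by
    intro p hp e f g hef heg hfg he hf hg
    have h₁ := apexLoc_src hef he hf hp
    have h₂ := apexLoc_src heg he hg hp
    have h₃ := apexLoc_src hfg hf hg hp
    tauto

end Layouts

/-- The number of vertices of the graph. -/
lemma card_vtx (k h m : ℕ) : Fintype.card (Vtx k h m) = m + k * (6 * h + 11) := by
  simp only [Fintype.card_sum, Fintype.card_prod, Fintype.card_option, Fintype.card_bool,
    Fintype.card_fin]
  ring

/-- For all `k ≥ 1` and `ℓ ≥ 3` there exists a `k`-apex
simple graph on exactly `n = 11ℓk - 5k + 1` vertices with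
`cr_{k-apex}(G) ≥ ℓk` and `cr(G) ≤ 3k` (hence the `k`-apex crossing ratio is
`Ω(n/k)`). -/
theorem k_apex_crossing_ratio_lower (k ℓ : ℕ) (hk : 1 ≤ k) (hℓ : 3 ≤ ℓ) :
    ∃ G : SimpleGraph (Fin (11 * ℓ * k - 5 * k + 1)),
      (∃ Γ : Drawing G, Γ.IsKApex k) ∧
      ℓ * k ≤ crNumRestricted G (fun Γ => Γ.IsKApex k) ∧
      crNum G ≤ 3 * k := by
  obtain ⟨h, hh⟩ : ∃ h, h = (ℓ + 1) / 2 := ⟨_, rfl⟩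
  have hle : k * (6 * h + 11) ≤ 11 * ℓ * k - 5 * k + 1 := by
    have h₁ : 6 * h + 11 + 5 ≤ 11 * ℓ := by omega
    have h₂ := Nat.mul_le_mul_left k h₁
    have h₃ : k * (6 * h + 11 + 5) = k * (6 * h + 11) + 5 * k := by ring
    have h₄ : k * (11 * ℓ) = 11 * ℓ * k := by ring
    omega
  obtain ⟨m, hm⟩ := Nat.exists_eq_add_of_le' hle
  have e : Fin (11 * ℓ * k - 5 * k + 1) ≃ Vtx k h m :=
    (Fintype.equivFinOfCardEq ((card_vtx k h m).trans hm.symm)).symm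
  let φ : (hubGraph k h m).comap e ≃g hubGraph k h m := SimpleGraph.Iso.comap e _
  obtain ⟨Γ, hΓ⟩ : ∃ Γ : Drawing ((hubGraph k h m).comap e), Γ.IsKApex k :=
    ⟨_, ((apexLayout h).isKApex_drawing (m := m) fun e f hef q he hf hq => by
      have := apexLoc_src hef he hf hq
      tauto).comap φ⟩
  have hcr : crNum ((hubGraph k h m).comap e) ≤ (((oneLayout h).drawing k m).comap φ).crossings :=
    Nat.sInf_le ⟨_, rfl⟩
  refine ⟨_, ⟨Γ, hΓ⟩, le_csInf ⟨_, Γ, hΓ, rfl⟩ ?_, hcr.trans ?_⟩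
  · rintro n ⟨Γ', hΓ', rfl⟩
    have := le_crossings_of_isKApex (by omega) (Γ'.comap φ.symm) (hΓ'.comap φ.symm)
    rw [Drawing.comap_crossings] at this
    refine le_trans ?_ this
    rw [mul_comm]
    exact Nat.mul_le_mul_left k (by omega)
  · rw [Drawing.comap_crossings]
    exact ((oneLayout h).crossings_drawing_le (8 / 3, 2)
      fun e f hef q he hf hq => (oneLoc_inter hef he hf hq).1).trans (by omega)
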